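/- arXiv:0909.2524 — 12 statements merged into one kernel-verified Lean document; each statement's English description precedes it below -/
import Mathlib

section
/- In the lion and man game on the closed unit disc D = {x ∈ ℝ² : |x| ≤ 1}, for any distinct starting points x_L, x_M ∈ D of the lion and the man, the man has a winning strategy: there is a man strategy Ψ such that for every lion path l and every t ≥ 0, Ψ(l)(t) ≠ l(t). (This is Besicovitch's strategy: the man runs successive straight segments of durations t_i = c/i, each perpendicular to his radius vector and into the half-plane not containing the lion.) -/
/-!
Lion and man on the closed unit disc: the man (Besicovitch) has a winning strategy,
for any distinct starting points in the disc.
-/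

open NNReal

noncomputable section

abbrev E2 := EuclideanSpace ℝ (Fin 2)

/-- The closed unit disc in the plane. -/
def Disc : Set E2 := Metric.closedBall 0 1

/-- A (speed at most 1) path in `S ⊆ E`, starting at `x`, defined on `[0,∞)`. -/
def IsPathIn {E : Type*} [MetricSpace E] (S : Set E) (x : E) (f : ℝ≥0 → E) : Prop :=
  f 0 = x ∧ LipschitzWith 1 f ∧ ∀ t, f t ∈ S

/-- A man strategy: a no-lookahead map from lion paths to man paths. -/
def IsManStrategyIn {E : Type*} [MetricSpace E] (S : Set E) (xL xM : E)
    (Ψ : (ℝ≥0 → E) → (ℝ≥0 → E)) : Prop :=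
  (∀ l, IsPathIn S xL l → IsPathIn S xM (Ψ l)) ∧
  ∀ l l', IsPathIn S xL l → IsPathIn S xL l' → ∀ t : ℝ≥0,
    (∀ s ≤ t, l s = l' s) → ∀ s ≤ t, Ψ l s = Ψ l' s

open scoped RealInnerProductSpace

/-- The vertices of the polygonal path that leaves its `n`-th vertex `p` at time `T n` with
velocity `U n p q`, where `q` is the lion's position at that time. -/
def vertex (T : ℕ → ℝ) (U : ℕ → E2 → E2 → E2) (x : E2) (l : ℝ≥0 → E2) : ℕ → E2
  | 0 => x
  | n + 1 => vertex T U x l n +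
      (T (n + 1) - T n) • U n (vertex T U x l n) (l (T n).toNNReal)

/-- The velocity of the polygonal path on its `n`-th segment. -/
def velocity (T : ℕ → ℝ) (U : ℕ → E2 → E2 → E2) (x : E2) (l : ℝ≥0 → E2) (n : ℕ) : E2 :=
  U n (vertex T U x l n) (l (T n).toNNReal)

/-- The polygonal path with `N` segments, at rest after time `T N`. -/
def polyPath (T : ℕ → ℝ) (U : ℕ → E2 → E2 → E2) (x : E2) (l : ℝ≥0 → E2) (N : ℕ) (t : ℝ) : E2 :=
  x + ∑ i ∈ Finset.range N, (min t (T (i + 1)) - min t (T i)) • velocity T U x l i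

section PolygonalPath

variable {T : ℕ → ℝ} {U : ℕ → E2 → E2 → E2} {x : E2} {l l' : ℝ≥0 → E2} {n N M : ℕ} {s t : ℝ}

lemma vertex_succ : vertex T U x l (n + 1) =
    vertex T U x l n + (T (n + 1) - T n) • velocity T U x l n := rfl

lemma polyPath_succ : polyPath T U x l (N + 1) t =
    polyPath T U x l N t + (min t (T (N + 1)) - min t (T N)) • velocity T U x l N := by
  simp [polyPath, Finset.sum_range_succ, add_assoc]

lemma polyPath_eq_vertex (hT : Monotone T) (h : T N ≤ t) :
    polyPath T U x l N t = vertex T U x l N := by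
  induction N with
  | zero => simp [polyPath, vertex]
  | succ N ih =>
    have h' := (hT N.le_succ).trans h
    rw [polyPath_succ, ih h', vertex_succ, min_eq_right h, min_eq_right h']

lemma polyPath_eq_of_le (hT : Monotone T) (hNM : N ≤ M) (h : t ≤ T N) :
    polyPath T U x l M t = polyPath T U x l N t := by
  induction M, hNM using Nat.le_induction with
  | base => rfl
  | succ M hM ih =>
    have h1 := h.trans (hT hM)
    rw [polyPath_succ, ih, min_eq_left h1, min_eq_left (h1.trans (hT M.le_succ)), sub_self,
      zero_smul, add_zero]

lemma polyPath_congr (hT : Monotone T) (hN : t ≤ T N) (hM : t ≤ T M) :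
    polyPath T U x l N t = polyPath T U x l M t := by
  rw [← polyPath_eq_of_le hT (le_max_left N M) hN, ← polyPath_eq_of_le hT (le_max_right N M) hM]

lemma polyPath_eq_segment (hT : Monotone T) (h1 : T n ≤ t) (h2 : t ≤ T (n + 1)) :
    polyPath T U x l (n + 1) t = vertex T U x l n + (t - T n) • velocity T U x l n := by
  rw [polyPath_succ, polyPath_eq_vertex hT h1, min_eq_left h2, min_eq_right h1]

lemma norm_polyPath_sub_le (hT : Monotone T) (hU : ∀ n, ‖velocity T U x l n‖ ≤ 1) (hst : s ≤ t) :
    ‖polyPath T U x l N t - polyPath T U x l N s‖ ≤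
      (min t (T N) - min t (T 0)) - (min s (T N) - min s (T 0)) := by
  induction N with
  | zero => simp [polyPath]
  | succ N ih =>
    have hT' := hT N.le_succ
    have hmono : 0 ≤ (min t (T (N + 1)) - min t (T N)) - (min s (T (N + 1)) - min s (T N)) := by
      simp only [Nat.succ_eq_add_one] at hT'
      grind
    have hstep : ‖((min t (T (N + 1)) - min t (T N)) - (min s (T (N + 1)) - min s (T N))) •
        velocity T U x l N‖ ≤
        (min t (T (N + 1)) - min t (T N)) - (min s (T (N + 1)) - min s (T N)) := by
      rw [norm_smul, Real.norm_of_nonneg hmono]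
      exact mul_le_of_le_one_right hmono (hU N)
    rw [polyPath_succ, polyPath_succ, add_sub_add_comm, ← sub_smul]
    linarith [norm_add_le_of_le ih hstep]

lemma vertex_eq_of_agree (hT : Monotone T) (h : ∀ r : ℝ≥0, (r : ℝ) ≤ t → l r = l' r)
    (h0 : 0 ≤ T 0) (hn : T n ≤ t) : vertex T U x l n = vertex T U x l' n := by
  induction n with
  | zero => rfl
  | succ n ih =>
    have hn' := (hT n.le_succ).trans hn
    have hl : l (T n).toNNReal = l' (T n).toNNReal := by
      apply h
      rwa [Real.coe_toNNReal _ (h0.trans (hT n.zero_le))]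
    simp only [vertex, ih hn', hl]

lemma velocity_eq_of_agree (hT : Monotone T) (h : ∀ r : ℝ≥0, (r : ℝ) ≤ t → l r = l' r)
    (h0 : 0 ≤ T 0) (hn : T n ≤ t) : velocity T U x l n = velocity T U x l' n := by
  have hl : l (T n).toNNReal = l' (T n).toNNReal := by
    apply h
    rwa [Real.coe_toNNReal _ (h0.trans (hT n.zero_le))]
  simp only [velocity, vertex_eq_of_agree hT h h0 hn, hl]

lemma polyPath_eq_of_agree (hT : Monotone T) (h : ∀ r : ℝ≥0, (r : ℝ) ≤ t → l r = l' r)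
    (h0 : 0 ≤ T 0) (hst : s ≤ t) : polyPath T U x l N s = polyPath T U x l' N s := by
  unfold polyPath
  congr 1
  refine Finset.sum_congr rfl fun i _ => ?_
  rcases le_total (T i) s with hi | hi
  · rw [velocity_eq_of_agree hT h h0 (hi.trans hst)]
  · rw [min_eq_left hi, min_eq_left (hi.trans (hT i.le_succ)), sub_self, zero_smul, zero_smul]

end PolygonalPath

lemma exists_unit_orthogonal_inner_nonpos (p q : E2) :
    ∃ u : E2, ‖u‖ = 1 ∧ ⟪p, u⟫ = 0 ∧ ⟪q, u⟫ ≤ 0 := by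
  obtain ⟨v, hv, hpv⟩ : ∃ v : E2, v ≠ 0 ∧ ⟪p, v⟫ = 0 := by
    by_cases hp : p = 0
    · exact ⟨EuclideanSpace.single 0 1, by simp, by simp [hp]⟩
    · refine ⟨!₂[-p 1, p 0], fun h => hp ?_, ?_⟩
      · have h0 := congrArg (fun w : E2 => w 0) h
        have h1 := congrArg (fun w : E2 => w 1) h
        ext i
        fin_cases i <;> simp_all
      · simp [PiLp.inner_apply, Fin.sum_univ_two]
        ring
  have hv' : ‖v‖ ≠ 0 := norm_ne_zero_iff.mpr hv
  have hw : ‖‖v‖⁻¹ • v‖ = 1 := by simp [norm_smul, hv']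
  have hpw : ⟪p, ‖v‖⁻¹ • v⟫ = 0 := by rw [inner_smul_right, hpv, mul_zero]
  rcases le_total ⟪q, ‖v‖⁻¹ • v⟫ 0 with h | h
  · exact ⟨_, hw, hpw, h⟩
  · exact ⟨-(‖v‖⁻¹ • v), by rwa [norm_neg], by rw [inner_neg_right, hpw, neg_zero],
      by rw [inner_neg_right]; linarith⟩

/-- A unit vector orthogonal to `p` pointing into a half-plane that does not contain `q`. -/
def escapeDir (p q : E2) : E2 := (exists_unit_orthogonal_inner_nonpos p q).choose

lemma norm_escapeDir (p q : E2) : ‖escapeDir p q‖ = 1 :=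
  (exists_unit_orthogonal_inner_nonpos p q).choose_spec.1

lemma inner_escapeDir_left (p q : E2) : ⟪p, escapeDir p q⟫ = 0 :=
  (exists_unit_orthogonal_inner_nonpos p q).choose_spec.2.1

lemma inner_escapeDir_right (p q : E2) : ⟪q, escapeDir p q⟫ ≤ 0 :=
  (exists_unit_orthogonal_inner_nonpos p q).choose_spec.2.2

lemma norm_add_smul_escapeDir_sq (p q : E2) (s : ℝ) :
    ‖p + s • escapeDir p q‖ ^ 2 = ‖p‖ ^ 2 + s ^ 2 := by
  rw [norm_add_sq_real, inner_smul_right, inner_escapeDir_left, norm_smul, norm_escapeDir]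
  simp

lemma lt_norm_add_smul_escapeDir_sub {p q : E2} (h : q ≠ p) {s : ℝ} (hs : 0 ≤ s) :
    s < ‖p + s • escapeDir p q - q‖ := by
  have hpos : 0 < ‖p - q‖ := norm_pos_iff.mpr (sub_ne_zero.mpr h.symm)
  have hsq : ‖p + s • escapeDir p q - q‖ ^ 2 =
      ‖p - q‖ ^ 2 + 2 * (s * -⟪q, escapeDir p q⟫) + s ^ 2 := by
    rw [show p + s • escapeDir p q - q = (p - q) + s • escapeDir p q by abel, norm_add_sq_real,
      inner_smul_right, inner_sub_left, inner_escapeDir_left, norm_smul, norm_escapeDir]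
    simp
  have hin := mul_nonneg hs (neg_nonneg.mpr (inner_escapeDir_right p q))
  refine lt_of_pow_lt_pow_left₀ 2 (norm_nonneg _) ?_
  rw [hsq]
  have := pow_pos hpos 2
  linarith

/-- The times at which the man changes direction. -/
def turnTime (a : ℝ) (n : ℕ) : ℝ := ∑ i ∈ Finset.range n, a / (i + 1)

lemma turnTime_succ (a : ℝ) (n : ℕ) : turnTime a (n + 1) = turnTime a n + a / (n + 1) :=
  Finset.sum_range_succ _ _

lemma turnTime_zero (a : ℝ) : turnTime a 0 = 0 := rfl

lemma monotone_turnTime {a : ℝ} (ha : 0 ≤ a) : Monotone (turnTime a) :=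
  monotone_nat_of_le_succ fun n => by
    rw [turnTime_succ]
    have : 0 ≤ a / ((n : ℝ) + 1) := by positivity
    linarith

lemma exists_le_turnTime {a : ℝ} (ha : 0 < a) (t : ℝ) : ∃ n, t ≤ turnTime a n := by
  have h : Filter.Tendsto (turnTime a) Filter.atTop Filter.atTop := by
    have := Real.tendsto_sum_range_one_div_nat_succ_atTop.const_mul_atTop ha
    refine this.congr fun n => ?_
    simp [turnTime, Finset.mul_sum, div_eq_mul_inv]
  exact (h.eventually_ge_atTop t).exists

lemma exists_turnTime_segment {a : ℝ} (ha : 0 < a) {t : ℝ} (ht : 0 ≤ t) :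
    ∃ n, turnTime a n ≤ t ∧ t ≤ turnTime a (n + 1) := by
  classical
  have hex : ∃ n, t ≤ turnTime a (n + 1) :=
    (exists_le_turnTime ha t).imp fun n hn => hn.trans (monotone_turnTime ha.le n.le_succ)
  refine ⟨Nat.find hex, ?_, Nat.find_spec hex⟩
  rcases h : Nat.find hex with _ | m
  · simpa [turnTime_zero] using ht
  · exact (not_le.mp (Nat.find_min hex (h ▸ m.lt_succ_self))).le

/-- The man first moves towards the centre, then repeatedly runs along escape directions. -/
def manDir (n : ℕ) (p q : E2) : E2 := if n = 0 then -p else escapeDir p q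

section Escape

variable {a : ℝ} {x y : E2} {l : ℝ≥0 → E2}

lemma velocity_zero {T : ℕ → ℝ} : velocity T manDir x l 0 = -x := by
  simp [velocity, manDir, vertex]

lemma velocity_of_ne_zero {T : ℕ → ℝ} {n : ℕ} (hn : n ≠ 0) : velocity T manDir x l n =
    escapeDir (vertex T manDir x l n) (l (T n).toNNReal) := by
  simp [velocity, manDir, hn]

lemma norm_velocity_le (hx : ‖x‖ ≤ 1) {T : ℕ → ℝ} (n : ℕ) :
    ‖velocity T manDir x l n‖ ≤ 1 := by
  rcases eq_or_ne n 0 with rfl | hn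
  · rwa [velocity_zero, norm_neg]
  · rw [velocity_of_ne_zero hn, norm_escapeDir]

lemma norm_vertex_succ_sq_le (ha : 0 ≤ a) (ha1 : a ≤ 1) (hx : ‖x‖ ≤ 1) (n : ℕ) :
    ‖vertex (turnTime a) manDir x l (n + 1)‖ ^ 2 ≤ 1 - 2 * a ^ 2 / (n + 2) := by
  induction n with
  | zero =>
    have h : vertex (turnTime a) manDir x l 1 = (1 - a) • x := by
      rw [vertex_succ, velocity_zero, turnTime_succ]
      simp [vertex, sub_smul, ← sub_eq_add_neg]
    rw [zero_add, h, norm_smul, Real.norm_of_nonneg (by linarith), mul_pow]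
    have hx2 : ‖x‖ ^ 2 ≤ 1 := pow_le_one₀ (norm_nonneg _) hx
    have := mul_le_of_le_one_right (sq_nonneg (1 - a)) hx2
    norm_num
    nlinarith
  | succ n ih =>
    rw [vertex_succ, velocity_of_ne_zero n.succ_ne_zero, norm_add_smul_escapeDir_sq,
      turnTime_succ a (n + 1), add_sub_cancel_left]
    have key : (a / ((n + 1 : ℕ) + 1 : ℝ)) ^ 2 ≤
        2 * a ^ 2 / (n + 2) - 2 * a ^ 2 / ((n + 1 : ℕ) + 2) := by
      have hn : (0 : ℝ) ≤ n := n.cast_nonneg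
      push_cast
      rw [div_sub_div _ _ (by positivity) (by positivity), div_pow,
        div_le_div_iff₀ (by positivity) (by positivity)]
      have : 0 ≤ a ^ 2 * (n + 2) * (n + 1 : ℝ) := by positivity
      nlinarith [mul_nonneg this (by positivity : (0 : ℝ) ≤ n + 2)]
    linarith

lemma norm_vertex_le (ha : 0 ≤ a) (ha1 : a ≤ 1) (hx : ‖x‖ ≤ 1) (n : ℕ) :
    ‖vertex (turnTime a) manDir x l n‖ ≤ 1 := by
  rcases n with _ | n
  · exact hx
  · have h := norm_vertex_succ_sq_le (l := l) ha ha1 hx n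
    have : 0 ≤ 2 * a ^ 2 / ((n : ℝ) + 2) := by positivity
    exact (sq_le_one_iff₀ (norm_nonneg _)).mp (by linarith)

lemma norm_segment_le (ha : 0 < a) (ha1 : a ≤ 1) (hx : ‖x‖ ≤ 1) {n : ℕ} {t : ℝ}
    (h1 : turnTime a n ≤ t) (h2 : t ≤ turnTime a (n + 1)) :
    ‖vertex (turnTime a) manDir x l n +
      (t - turnTime a n) • velocity (turnTime a) manDir x l n‖ ≤ 1 := by
  set d := turnTime a (n + 1) - turnTime a n with hd
  have hdpos : 0 < d := by
    rw [hd, turnTime_succ, add_sub_cancel_left]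
    positivity
  have hconv := (convex_closedBall (0 : E2) 1).add_smul_mem
    (x := vertex (turnTime a) manDir x l n) (y := d • velocity (turnTime a) manDir x l n)
    (by simpa using norm_vertex_le ha.le ha1 hx n)
    (by simpa [vertex_succ] using norm_vertex_le (l := l) ha.le ha1 hx (n + 1))
    (t := (t - turnTime a n) / d)
    ⟨div_nonneg (by linarith) hdpos.le, (div_le_one hdpos).mpr (by linarith)⟩
  rwa [smul_smul, div_mul_cancel₀ _ hdpos.ne', mem_closedBall_zero_iff] at hconv

lemma segment_ne_lion (ha : 0 < a) (hx : ‖x‖ ≤ 1) (hl0 : l 0 = y) (hl : LipschitzWith 1 l)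
    (hay : 2 * a < ‖x - y‖) {n : ℕ}
    (hn : l (turnTime a n).toNNReal ≠ vertex (turnTime a) manDir x l n)
    {t : ℝ≥0} (h1 : turnTime a n ≤ t) (h2 : t ≤ turnTime a (n + 1)) :
    vertex (turnTime a) manDir x l n +
      ((t : ℝ) - turnTime a n) • velocity (turnTime a) manDir x l n ≠ l t := by
  have hT0 : 0 ≤ turnTime a n := monotone_turnTime ha.le n.zero_le
  have hs : 0 ≤ (t : ℝ) - turnTime a n := sub_nonneg.mpr h1
  have hdist : ‖l t - l (turnTime a n).toNNReal‖ ≤ t - turnTime a n := by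
    have := hl.dist_le_mul t (turnTime a n).toNNReal
    rwa [NNReal.coe_one, one_mul, dist_eq_norm, NNReal.dist_eq, Real.coe_toNNReal _ hT0,
      abs_of_nonneg hs] at this
  intro heq
  rw [← heq] at hdist
  refine absurd hdist (not_le.mpr ?_)
  rcases eq_or_ne n 0 with rfl | hn0
  · rw [velocity_zero, turnTime_zero, Real.toNNReal_zero, hl0, sub_zero]
    have hta : (t : ℝ) ≤ a := by simpa [turnTime] using h2
    have hsm : ‖(t : ℝ) • x‖ ≤ t := by
      rw [norm_smul, Real.norm_of_nonneg t.coe_nonneg]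
      exact mul_le_of_le_one_right t.coe_nonneg hx
    have := norm_sub_norm_le (x - y) ((t : ℝ) • x)
    rw [show vertex (turnTime a) manDir x l 0 + (t : ℝ) • -x - y = x - y - (t : ℝ) • x by
      simp only [vertex, smul_neg]; abel]
    linarith
  · rw [velocity_of_ne_zero hn0]
    exact lt_norm_add_smul_escapeDir_sub hn hs

lemma lion_ne_vertex (ha : 0 < a) (hx : ‖x‖ ≤ 1) (hl0 : l 0 = y) (hl : LipschitzWith 1 l)
    (hay : 2 * a < ‖x - y‖) (n : ℕ) :
    l (turnTime a n).toNNReal ≠ vertex (turnTime a) manDir x l n := by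
  induction n with
  | zero =>
    rw [turnTime_zero, Real.toNNReal_zero, hl0]
    rintro rfl
    simp at hay
    linarith
  | succ n ih =>
    have hT0 : 0 ≤ turnTime a (n + 1) := monotone_turnTime ha.le (n + 1).zero_le
    have hmono := monotone_turnTime ha.le n.le_succ
    have h := segment_ne_lion ha hx hl0 hl hay ih (t := (turnTime a (n + 1)).toNNReal)
      (by rwa [Real.coe_toNNReal _ hT0]) (by rw [Real.coe_toNNReal _ hT0])
    rw [Real.coe_toNNReal _ hT0] at h
    exact h.symm

end Escape

/-- In the lion and man game on the closed unit disc, for any distinct starting points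
the man has a winning strategy: a strategy `Ψ` such that for every lion path `l` and
every time `t ≥ 0`, `Ψ l t ≠ l t`. -/
theorem man_wins_in_disc (xL xM : E2) (hL : xL ∈ Disc) (hM : xM ∈ Disc) (hne : xL ≠ xM) :
    ∃ Ψ, IsManStrategyIn Disc xL xM Ψ ∧
      ∀ l, IsPathIn Disc xL l → ∀ t : ℝ≥0, Ψ l t ≠ l t := by
  have hx : ‖xM‖ ≤ 1 := by simpa [Disc] using hM
  have hy : ‖xL‖ ≤ 1 := by simpa [Disc] using hL
  have hd : 0 < ‖xM - xL‖ := norm_pos_iff.mpr (sub_ne_zero.mpr hne.symm)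
  obtain ⟨a, ha_def⟩ : ∃ a, a = ‖xM - xL‖ / 4 := ⟨_, rfl⟩
  have ha : 0 < a := by linarith
  have ha1 : a ≤ 1 := by linarith [norm_sub_le xM xL]
  have hay : 2 * a < ‖xM - xL‖ := by linarith
  have hT := monotone_turnTime ha.le
  choose N hN using exists_le_turnTime ha
  let Ψ : (ℝ≥0 → E2) → ℝ≥0 → E2 := fun l t => polyPath (turnTime a) manDir xM l (N t) t
  have hΨ : ∀ l (t : ℝ≥0), ∃ n, turnTime a n ≤ t ∧ t ≤ turnTime a (n + 1) ∧
      Ψ l t = vertex (turnTime a) manDir xM l n +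
        ((t : ℝ) - turnTime a n) • velocity (turnTime a) manDir xM l n := by
    intro l t
    obtain ⟨n, h1, h2⟩ := exists_turnTime_segment ha t.2
    exact ⟨n, h1, h2, (polyPath_congr hT (hN t) h2).trans (polyPath_eq_segment hT h1 h2)⟩
  refine ⟨Ψ, ⟨fun l _ => ⟨?_, ?_, fun t => ?_⟩, fun l l' _ _ t h s hst => ?_⟩, fun l hl t => ?_⟩
  · have h0 : ((0 : ℝ≥0) : ℝ) ≤ turnTime a 0 := le_rfl
    exact (polyPath_congr hT (hN _) h0).trans (polyPath_eq_vertex hT le_rfl)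
  · have key : ∀ s t : ℝ≥0, s ≤ t → dist (Ψ l t) (Ψ l s) ≤ t - s := by
      intro s t hst
      have hst' : (s : ℝ) ≤ t := hst
      have hs := polyPath_congr (U := manDir) (x := xM) (l := l) hT (hN s) (hst'.trans (hN t))
      have h := norm_polyPath_sub_le (N := N t) (s := s) (t := t) hT
        (norm_velocity_le (l := l) hx) hst'
      rw [min_eq_left (hN t), min_eq_left (hst'.trans (hN t)), turnTime_zero,
        min_eq_right t.coe_nonneg,
        min_eq_right s.coe_nonneg, sub_zero, sub_zero] at h
      simp only [Ψ]
      rwa [hs, dist_eq_norm]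
    refine LipschitzWith.of_dist_le_mul fun s t => ?_
    rw [NNReal.coe_one, one_mul, NNReal.dist_eq]
    rcases le_total s t with hst | hst
    · rw [dist_comm, abs_sub_comm]
      exact (key s t hst).trans (le_abs_self _)
    · exact (key t s hst).trans (le_abs_self _)
  · obtain ⟨n, h1, h2, h⟩ := hΨ l t
    rw [h, Disc, mem_closedBall_zero_iff]
    exact norm_segment_le ha ha1 hx h1 h2
  · exact polyPath_eq_of_agree hT (t := (t : ℝ)) (fun r hr => h r hr) le_rfl hst
  · obtain ⟨n, h1, h2, h⟩ := hΨ l t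
    rw [h]
    exact segment_ne_lion ha hx hl.1 hl.2.1 hay (lion_ne_vertex ha hx hl.1 hl.2.1 hay n) h1 h2


end
end

section
/- In the lion and man game on the closed unit disc D = {x ∈ ℝ² : |x| ≤ 1}, for any distinct starting points of lion and man, the lion has no winning strategy: for every lion strategy Φ there exist a lion path l and a man path m with Φ(m) = l and l(t) ≠ m(t) for all t ≥ 0. -/
/-!
Lion and man on the closed unit disc: the lion has no winning strategy,
for any distinct starting points in the disc.
-/

open NNReal

noncomputable section

/-- A lion strategy: a no-lookahead map from man paths to lion paths. -/
def IsLionStrategyIn {E : Type*} [MetricSpace E] (S : Set E) (xL xM : E)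
    (Φ : (ℝ≥0 → E) → (ℝ≥0 → E)) : Prop :=
  (∀ m, IsPathIn S xM m → IsPathIn S xL (Φ m)) ∧
  ∀ m m', IsPathIn S xM m → IsPathIn S xM m' → ∀ t : ℝ≥0,
    (∀ s ≤ t, m s = m' s) → ∀ s ≤ t, Φ m s = Φ m' s

lemma IsPathIn.dist_le {E : Type*} [MetricSpace E] {S : Set E} {x : E} {f : ℝ≥0 → E}
    (hf : IsPathIn S x f) (s t : ℝ≥0) : dist (f s) (f t) ≤ |(s : ℝ) - t| := by
  simpa [NNReal.dist_eq] using hf.2.1.dist_le_mul s t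

/-- A map on `[0,∞)` has speed at most one if this holds for increasing pairs of times. -/
lemma lipschitzWith_one_of_le {E : Type*} [MetricSpace E] {f : ℝ≥0 → E}
    (h : ∀ s t : ℝ≥0, s ≤ t → dist (f s) (f t) ≤ (t : ℝ) - s) : LipschitzWith 1 f := by
  refine LipschitzWith.of_dist_le_mul fun s t => ?_
  rw [NNReal.coe_one, one_mul, NNReal.dist_eq]
  rcases le_total s t with hst | hst
  · exact (h s t hst).trans (by rw [abs_sub_comm]; exact le_abs_self _)
  · rw [dist_comm]
    exact (h t s hst).trans (le_abs_self _)

lemma exists_unit_inner_eq_zero (p : E2) : ∃ u : E2, ‖u‖ = 1 ∧ inner ℝ u p = 0 := by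
  obtain ⟨v, hv, hvp⟩ : ∃ v : E2, v ≠ 0 ∧ inner ℝ v p = 0 := by
    by_cases hp : p = 0
    · exact ⟨EuclideanSpace.single 0 1, by simp, by simp [hp]⟩
    · refine ⟨!₂[-p 1, p 0], fun h => hp ?_, ?_⟩
      · have h0 := congrArg (fun w : E2 => w 0) h
        have h1 := congrArg (fun w : E2 => w 1) h
        ext i
        fin_cases i
        · simpa using h1
        · simpa using h0
      · simp [PiLp.inner_apply, Fin.sum_univ_two]
        ring
  exact ⟨‖v‖⁻¹ • v, by rw [norm_smul, norm_inv, norm_norm, inv_mul_cancel₀ (norm_ne_zero_iff.2 hv)],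
    by rw [real_inner_smul_left, hvp, mul_zero]⟩

/-- Besicovitch's direction: orthogonal to the radius through `p` and not towards `q`. -/
lemma exists_unit_inner_eq_zero_inner_nonpos (p q : E2) :
    ∃ u : E2, ‖u‖ = 1 ∧ inner ℝ u p = 0 ∧ inner ℝ u q ≤ 0 := by
  obtain ⟨u, hu, hup⟩ := exists_unit_inner_eq_zero p
  rcases le_total (inner ℝ u q) 0 with h | h
  · exact ⟨u, hu, hup, h⟩
  · exact ⟨-u, by simpa using hu, by simpa using hup, by simpa using h⟩

lemma norm_add_smul_sq_of_unit {u p : E2} (hu : ‖u‖ = 1) (a : ℝ) :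
    ‖p + a • u‖ ^ 2 = ‖p‖ ^ 2 + 2 * a * inner ℝ u p + a ^ 2 := by
  rw [norm_add_sq_real, real_inner_smul_right, norm_smul, hu, real_inner_comm, Real.norm_eq_abs,
    mul_one, sq_abs]
  ring

/-- Follow `f` until time `T`, then go in direction `u` for time `δ`, then stop. -/
def turnAt (f : ℝ≥0 → E2) (T δ : ℝ≥0) (u : E2) (t : ℝ≥0) : E2 :=
  f (min t T) + (min (t - T) δ : ℝ≥0) • u

lemma turnAt_of_le {f : ℝ≥0 → E2} {T δ : ℝ≥0} {u : E2} {t : ℝ≥0} (h : t ≤ T) :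
    turnAt f T δ u t = f t := by
  simp [turnAt, h, tsub_eq_zero_of_le h]

lemma turnAt_of_ge {f : ℝ≥0 → E2} {T δ : ℝ≥0} {u : E2} {t : ℝ≥0} (h : T ≤ t) :
    turnAt f T δ u t = f T + (min (t - T) δ : ℝ≥0) • u := by
  simp [turnAt, h]

lemma isPathIn_turnAt {f : ℝ≥0 → E2} {T δ : ℝ≥0} {x u : E2} (hf : IsPathIn Disc x f)
    (hu : ‖u‖ = 1) (hup : inner ℝ u (f T) = 0) (hδ : ‖f T‖ ^ 2 + (δ : ℝ) ^ 2 ≤ 1) :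
    IsPathIn Disc x (turnAt f T δ u) := by
  refine ⟨by rw [turnAt_of_le zero_le, hf.1], lipschitzWith_one_of_le fun s t hst => ?_,
    fun t => ?_⟩
  · have hmono : min (s - T) δ ≤ min (t - T) δ := by gcongr
    have hmin : min s T ≤ min t T := by gcongr
    have hsum : min t T + min (t - T) δ + s ≤ min s T + min (s - T) δ + t := by
      rcases le_total t T with h | h
      · simp [h, hst.trans h, tsub_eq_zero_of_le h, tsub_eq_zero_of_le (hst.trans h), add_comm]
      rcases le_total s T with h' | h'
      · have : T + min (t - T) δ ≤ t := by
          calc T + min (t - T) δ ≤ T + (t - T) := by gcongr; exact min_le_left _ _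
            _ = t := add_tsub_cancel_of_le h
        simpa [h, h', tsub_eq_zero_of_le h', add_comm s] using this
      · obtain ⟨a, rfl⟩ := exists_add_of_le h'
        obtain ⟨b, rfl⟩ := exists_add_of_le hst
        have e : T + a + b - T = a + b := by rw [add_assoc, add_tsub_cancel_left]
        rw [e, add_tsub_cancel_left, min_eq_right h, min_eq_right h']
        have : min (a + b) δ ≤ min a δ + b := by
          rcases le_total a δ with h1 | h1
          · rw [min_eq_left h1]; exact min_le_left _ _
          · rw [min_eq_right h1]; exact (min_le_right _ _).trans le_self_add
        calc T + min (a + b) δ + (T + a) ≤ T + (min a δ + b) + (T + a) := by gcongr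
          _ = _ := by ring
    have h1 := hf.dist_le (min s T) (min t T)
    rw [abs_sub_comm, abs_of_nonneg (sub_nonneg.2 (NNReal.coe_le_coe.2 hmin))] at h1
    have h2 : dist ((min (s - T) δ : ℝ≥0) • u) ((min (t - T) δ : ℝ≥0) • u)
        = ((min (t - T) δ : ℝ≥0) : ℝ) - (min (s - T) δ : ℝ≥0) := by
      rw [dist_comm, dist_eq_norm, NNReal.smul_def, NNReal.smul_def, ← sub_smul, norm_smul, hu,
        mul_one, Real.norm_of_nonneg (sub_nonneg.2 (NNReal.coe_le_coe.2 hmono))]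
    have h3 := NNReal.coe_le_coe.2 hsum
    rw [NNReal.coe_add, NNReal.coe_add, NNReal.coe_add, NNReal.coe_add] at h3
    refine (dist_add_add_le _ _ _ _).trans ?_
    rw [h2]
    linarith
  · rcases le_total t T with h | h
    · rw [turnAt_of_le h]; exact hf.2.2 t
    · rw [turnAt_of_ge h, Disc, mem_closedBall_zero_iff, NNReal.smul_def]
      have h1 := norm_add_smul_sq_of_unit (p := f T) hu ((min (t - T) δ : ℝ≥0) : ℝ)
      have h2 : ((min (t - T) δ : ℝ≥0) : ℝ) ^ 2 ≤ (δ : ℝ) ^ 2 := by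
        have := NNReal.coe_le_coe.2 (min_le_right (t - T) δ)
        gcongr
      rw [hup, mul_zero, add_zero] at h1
      exact (sq_le_one_iff₀ (norm_nonneg _)).1 (by linarith)

/-- One step of Besicovitch's escape: an uncaught man can go on for time `δ` without being
caught, while the square of his distance from the centre grows by at most `δ ^ 2`. -/
lemma exists_escape_step {xL xM : E2} {Φ : (ℝ≥0 → E2) → (ℝ≥0 → E2)}
    (hΦ : IsLionStrategyIn Disc xL xM Φ) {f : ℝ≥0 → E2} (hf : IsPathIn Disc xM f) {T δ : ℝ≥0}
    (hδ : ‖f T‖ ^ 2 + (δ : ℝ) ^ 2 ≤ 1) (hfree : ∀ s ≤ T, Φ f s ≠ f s) :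
    ∃ g, IsPathIn Disc xM g ∧ (∀ s ≤ T, g s = f s) ∧
      ‖g (T + δ)‖ ^ 2 = ‖f T‖ ^ 2 + (δ : ℝ) ^ 2 ∧ ∀ s ≤ T + δ, Φ g s ≠ g s := by
  obtain ⟨u, hu, hup, huq⟩ := exists_unit_inner_eq_zero_inner_nonpos (f T) (Φ f T)
  have hg := isPathIn_turnAt hf hu hup hδ
  have hagree : ∀ s ≤ T, turnAt f T δ u s = f s := fun s hs => turnAt_of_le hs
  have hΦagree := hΦ.2 _ _ hg hf T hagree
  refine ⟨turnAt f T δ u, hg, hagree, ?_, fun s hs heq => ?_⟩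
  · rw [turnAt_of_ge le_self_add, add_tsub_cancel_left, min_self, NNReal.smul_def,
      norm_add_smul_sq_of_unit hu, hup]
    ring
  rcases le_total s T with h | h
  · exact hfree s h (by rw [← hΦagree s h, heq, hagree s h])
  obtain ⟨a, rfl⟩ := exists_add_of_le h
  have ha : a ≤ δ := by simpa using hs
  have hlion := (hΦ.1 _ hg).dist_le (T + a) T
  rw [heq, hΦagree T le_rfl, turnAt_of_ge h, add_tsub_cancel_left, min_eq_left ha,
    NNReal.smul_def, NNReal.coe_add, add_sub_cancel_left, abs_of_nonneg a.coe_nonneg,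
    dist_eq_norm, add_sub_right_comm] at hlion
  have h1 := norm_add_smul_sq_of_unit (p := f T - Φ f T) hu (a : ℝ)
  rw [inner_sub_right, hup] at h1
  have h2 : ‖f T - Φ f T + (a : ℝ) • u‖ ^ 2 ≤ (a : ℝ) ^ 2 := by gcongr
  have h3 : 0 < ‖f T - Φ f T‖ := norm_pos_iff.2 (sub_ne_zero.2 (hfree T le_rfl).symm)
  have h4 : (a : ℝ) * inner ℝ u (Φ f T) ≤ 0 :=
    mul_nonpos_of_nonneg_of_nonpos a.coe_nonneg huq
  nlinarith [pow_pos h3 2]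

/-- The man starts by moving towards the centre, far from the lion. -/
lemma exists_escape_start {xL xM : E2} (hM : xM ∈ Disc) {Φ : (ℝ≥0 → E2) → (ℝ≥0 → E2)}
    (hΦ : IsLionStrategyIn Disc xL xM Φ) {ε : ℝ≥0} (hε1 : ε ≤ 1)
    (hε : 2 * (ε : ℝ) < dist xL xM) :
    ∃ f, IsPathIn Disc xM f ∧ ‖f ε‖ ^ 2 ≤ 1 - (ε : ℝ) ∧ ∀ s ≤ ε, Φ f s ≠ f s := by
  have hM1 : ‖xM‖ ≤ 1 := mem_closedBall_zero_iff.1 hM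
  have hε1' : (ε : ℝ) ≤ 1 := by exact_mod_cast hε1
  have hnorm : ∀ t : ℝ≥0, ‖(1 - ((min t ε : ℝ≥0) : ℝ)) • xM‖ ≤ 1 - ((min t ε : ℝ≥0) : ℝ) := by
    intro t
    have h : ((min t ε : ℝ≥0) : ℝ) ≤ ε := NNReal.coe_le_coe.2 (min_le_right _ _)
    rw [norm_smul, Real.norm_of_nonneg (by linarith)]
    exact mul_le_of_le_one_right (by linarith) hM1
  have hf : IsPathIn Disc xM fun t => (1 - ((min t ε : ℝ≥0) : ℝ)) • xM := by
    refine ⟨by simp, lipschitzWith_one_of_le fun s t hst => ?_, fun t => ?_⟩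
    · have h1 : ((min s ε : ℝ≥0) : ℝ) ≤ (min t ε : ℝ≥0) :=
        NNReal.coe_le_coe.2 (min_le_min_right _ hst)
      have h2 : ((min t ε : ℝ≥0) : ℝ) - (min s ε : ℝ≥0) ≤ t - s := by
        have : (s : ℝ) ≤ t := hst
        push_cast
        rcases min_cases (t : ℝ) ε with h | h <;> rcases min_cases (s : ℝ) ε with h' | h' <;>
          linarith
      rw [dist_eq_norm, ← sub_smul, norm_smul, sub_sub_sub_cancel_left,
        Real.norm_of_nonneg (sub_nonneg.2 h1)]
      exact (mul_le_of_le_one_right (sub_nonneg.2 h1) hM1).trans h2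
    · exact mem_closedBall_zero_iff.2 ((hnorm t).trans (sub_le_self _ (NNReal.coe_nonneg _)))
  refine ⟨_, hf, ?_, fun s hs heq => ?_⟩
  · have h := hnorm ε
    simp only [min_self] at h ⊢
    have h2 : ‖(1 - (ε : ℝ)) • xM‖ ^ 2 ≤ (1 - (ε : ℝ)) ^ 2 := by gcongr
    nlinarith [ε.coe_nonneg]
  · have h1 := hf.dist_le s 0
    have h2 := (hΦ.1 _ hf).dist_le s 0
    rw [show (1 - ((min 0 ε : ℝ≥0) : ℝ)) • xM = xM from hf.1, NNReal.coe_zero, sub_zero,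
      abs_of_nonneg s.coe_nonneg] at h1
    rw [(hΦ.1 _ hf).1, heq, NNReal.coe_zero, sub_zero, abs_of_nonneg s.coe_nonneg] at h2
    have h3 := dist_triangle_left xL xM ((1 - ((min s ε : ℝ≥0) : ℝ)) • xM)
    have h4 : (s : ℝ) ≤ ε := hs
    linarith

/-- Paths that agree on longer and longer initial intervals have a common limit path. -/
lemma exists_limit_path {E : Type*} [MetricSpace E] {S : Set E} {x : E} {F : ℕ → ℝ≥0 → E}
    {T : ℕ → ℝ≥0} (hF : ∀ n, IsPathIn S x (F n)) (hT : Monotone T)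
    (hunb : ∀ t, ∃ n, t ≤ T n) (hagree : ∀ n, ∀ s ≤ T n, F (n + 1) s = F n s) :
    ∃ m, IsPathIn S x m ∧ ∀ n, ∀ s ≤ T n, m s = F n s := by
  have hle : ∀ k n, k ≤ n → ∀ s ≤ T k, F n s = F k s := by
    intro k n hkn
    induction n, hkn using Nat.le_induction with
    | base => exact fun _ _ => rfl
    | succ n hkn ih => exact fun s hs => (hagree n s (hs.trans (hT hkn))).trans (ih s hs)
  choose N hN using hunb
  have hm : ∀ n, ∀ s ≤ T n, F (N s) s = F n s := by
    intro n s hs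
    rcases le_total (N s) n with h | h
    · exact (hle _ _ h s (hN s)).symm
    · exact hle _ _ h s hs
  refine ⟨fun t => F (N t) t, ⟨(hF _).1, lipschitzWith_one_of_le fun s t hst => ?_,
    fun t => (hF _).2.2 t⟩, hm⟩
  rw [hm (N t) s (hst.trans (hN t))]
  refine ((hF (N t)).dist_le s t).trans ?_
  rw [abs_sub_comm, abs_of_nonneg (sub_nonneg.2 (NNReal.coe_le_coe.2 hst))]

/-- In the lion and man game on the closed unit disc, for any distinct starting points,
the lion has no winning strategy: for every lion strategy `Φ` there are a lion path `l`
and a man path `m` with `Φ m = l` and `l t ≠ m t` for all `t ≥ 0`. -/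
theorem lion_does_not_win_in_disc (xL xM : E2) (hL : xL ∈ Disc) (hM : xM ∈ Disc)
    (hne : xL ≠ xM) (Φ : (ℝ≥0 → E2) → (ℝ≥0 → E2)) (hΦ : IsLionStrategyIn Disc xL xM Φ) :
    ∃ l m, IsPathIn Disc xL l ∧ IsPathIn Disc xM m ∧ Φ m = l ∧
      ∀ t : ℝ≥0, l t ≠ m t := by
  obtain ⟨ε, hε0, hε1, hε⟩ : ∃ ε : ℝ≥0, 0 < ε ∧ ε ≤ 1 ∧ 2 * (ε : ℝ) < dist xL xM := by
    have hd : 0 < nndist xL xM := by simpa [pos_iff_ne_zero] using hne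
    refine ⟨min 1 (nndist xL xM / 3), by positivity, min_le_left _ _, ?_⟩
    have h : ((min 1 (nndist xL xM / 3) : ℝ≥0) : ℝ) ≤ (nndist xL xM / 3 : ℝ≥0) :=
      NNReal.coe_le_coe.2 (min_le_right _ _)
    have hd' : 0 < dist xL xM := dist_pos.2 hne
    rw [NNReal.coe_div, coe_nndist, NNReal.coe_ofNat] at h
    linarith
  have hε0' : (0 : ℝ) < ε := hε0
  have hε1' : (ε : ℝ) ≤ 1 := hε1
  let T : ℕ → ℝ≥0 := fun n => ε + ∑ k ∈ Finset.range n, ε / 2 / (k + 1)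
  have hT : ∀ n, T (n + 1) = T n + ε / 2 / (n + 1) := fun n => by
    simp only [T, Finset.sum_range_succ, add_assoc]
  have hTmono : Monotone T := monotone_nat_of_le_succ fun n => by rw [hT]; exact le_self_add
  have hTunb : ∀ t, ∃ n, t ≤ T n := by
    intro t
    obtain ⟨n, hn⟩ := (Real.tendsto_sum_range_one_div_nat_succ_atTop.eventually_ge_atTop
      ((t : ℝ) / (ε / 2))).exists
    refine ⟨n, NNReal.coe_le_coe.1 ?_⟩
    have h : (T n : ℝ) = ε + ε / 2 * ∑ k ∈ Finset.range n, 1 / ((k : ℝ) + 1) := by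
      simp [T, Finset.mul_sum, div_eq_mul_inv]
    rw [div_le_iff₀' (by positivity)] at hn
    linarith
  let P : ℕ → (ℝ≥0 → E2) → Prop := fun n f =>
    IsPathIn Disc xM f ∧ ‖f (T n)‖ ^ 2 ≤ 1 - (ε : ℝ) / (n + 1) ∧ ∀ s ≤ T n, Φ f s ≠ f s
  have hstep : ∀ n f, P n f → ∃ g, P (n + 1) g ∧ ∀ s ≤ T n, g s = f s := by
    rintro n f ⟨hf, hnorm, hfree⟩
    have hc : ((ε / 2 / (n + 1) : ℝ≥0) : ℝ) = (ε : ℝ) / 2 / (n + 1) := by push_cast; rfl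
    have hbound : 1 - (ε : ℝ) / (n + 1) + ((ε : ℝ) / 2 / (n + 1)) ^ 2
        ≤ 1 - (ε : ℝ) / ((n + 1 : ℕ) + 1) := by
      have h0 : (0 : ℝ) ≤ n := n.cast_nonneg
      have h : 1 - (ε : ℝ) / ((n + 1 : ℕ) + 1)
          - (1 - (ε : ℝ) / (n + 1) + ((ε : ℝ) / 2 / (n + 1)) ^ 2)
          = ε * (4 * (n + 1) - ε * (n + 2)) / (4 * (n + 1) ^ 2 * (n + 2)) := by
        push_cast
        field_simp
        ring
      have h' : (0 : ℝ) ≤ ε * (4 * (n + 1) - ε * (n + 2)) / (4 * (n + 1) ^ 2 * (n + 2)) := by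
        have : (0 : ℝ) ≤ 4 * (n + 1) - ε * (n + 2) := by nlinarith
        positivity
      linarith
    have hpos : (0 : ℝ) ≤ (ε : ℝ) / ((n + 1 : ℕ) + 1) := by positivity
    obtain ⟨g, hg, hgf, hgnorm, hgfree⟩ := exists_escape_step hΦ hf
      (δ := ε / 2 / (n + 1)) (by rw [hc]; linarith) hfree
    rw [← hT] at hgnorm hgfree
    exact ⟨g, ⟨hg, by rw [hgnorm, hc]; linarith, hgfree⟩, hgf⟩
  choose! G hGP hG using hstep
  obtain ⟨f₀, hf₀, hf₀norm, hf₀free⟩ := exists_escape_start hM hΦ hε1 hε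
  let F : ℕ → ℝ≥0 → E2 := fun n => Nat.rec f₀ G n
  have hFP : ∀ n, P n (F n) := by
    intro n
    induction n with
    | zero => exact ⟨hf₀, by simpa [T, F] using hf₀norm, by simpa [T, F] using hf₀free⟩
    | succ n ih => exact hGP n _ ih
  obtain ⟨m, hm, hmF⟩ := exists_limit_path (fun n => (hFP n).1) hTmono hTunb
    fun n => hG n _ (hFP n)
  refine ⟨Φ m, m, hΦ.1 m hm, hm, rfl, fun t => ?_⟩
  obtain ⟨n, hn⟩ := hTunb t
  rw [hΦ.2 m (F n) hm (hFP n).1 (T n) (hmF n) t hn, hmF n t hn]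
  exact (hFP n).2.2 t hn

end
end

section
/- Let X be a metric space with fixed starting points, and fix a time horizon T > 0. Suppose there exist ε > 0 with T = nε for some integer n, and a man strategy for the ε-discrete bounded-time game (with the man moving first) which guarantees that in every play the minimum distance between lion and man strictly exceeds ε. Then the man has a winning strategy for the continuous bounded-time game on X with horizon T. -/
/-!
If for some ε > 0 with T = nε the man has a strategy in the ε-discrete bounded-time
game (man moving first) guaranteeing that the minimum distance strictly exceeds ε,
then the man has a winning strategy for the continuous bounded-time game.
-/

open NNReal

noncomputable section

/-- A (speed at most 1) path in `X` starting at `x`, defined on `[0,∞)`. -/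
def IsPath {X : Type*} [MetricSpace X] (x : X) (f : ℝ≥0 → X) : Prop :=
  f 0 = x ∧ LipschitzWith 1 f

/-- A man strategy for the continuous game: a no-lookahead map from lion paths
to man paths. -/
def IsManStrategy {X : Type*} [MetricSpace X] (xL xM : X)
    (Ψ : (ℝ≥0 → X) → (ℝ≥0 → X)) : Prop :=
  (∀ l, IsPath xL l → IsPath xM (Ψ l)) ∧
  ∀ l l', IsPath xL l → IsPath xL l' → ∀ t : ℝ≥0,
    (∀ s ≤ t, l s = l' s) → ∀ s ≤ t, Ψ l s = Ψ l' s

/-- A man strategy for the ε-discrete game with the man moving first: the man's path on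
the time block `[0,(k+1)ε]` depends only on the lion's path on `[0,kε]`. -/
def IsDiscreteManStrategyManFirst {X : Type*} [MetricSpace X] (xL xM : X) (ε : ℝ≥0)
    (Ψ : (ℝ≥0 → X) → (ℝ≥0 → X)) : Prop :=
  (∀ l, IsPath xL l → IsPath xM (Ψ l)) ∧
  ∀ l l', IsPath xL l → IsPath xL l' → ∀ k : ℕ,
    (∀ s ≤ (k : ℝ≥0) * ε, l s = l' s) →
    ∀ s ≤ ((k : ℝ≥0) + 1) * ε, Ψ l s = Ψ l' s

/-- A strategy that commits to each time block before seeing the lion's moves in that block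
has no lookahead. -/
theorem IsDiscreteManStrategyManFirst.isManStrategy {X : Type*} [MetricSpace X] {xL xM : X}
    {ε : ℝ≥0} (hε : 0 < ε) {Ψ : (ℝ≥0 → X) → (ℝ≥0 → X)}
    (hΨ : IsDiscreteManStrategyManFirst xL xM ε Ψ) : IsManStrategy xL xM Ψ := by
  refine ⟨hΨ.1, fun l l' hl hl' t hagree s hs => ?_⟩
  have hfloor : (⌊t / ε⌋₊ : ℝ≥0) * ε ≤ t := (le_div_iff₀ hε).1 (Nat.floor_le zero_le)
  have hlt : t < ((⌊t / ε⌋₊ : ℝ≥0) + 1) * ε := (div_lt_iff₀ hε).1 (Nat.lt_floor_add_one _)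
  exact hΨ.2 l l' hl hl' ⌊t / ε⌋₊ (fun r hr => hagree r (hr.trans hfloor)) s (hs.trans hlt.le)

/-- If for some ε (dividing T) the man has an ε-discrete strategy (man first) keeping the
distance to the lion strictly greater than ε throughout `[0,T]`, then the man wins the
continuous bounded-time game with horizon `T`. -/
theorem discrete_man_win_implies_continuous_man_win
    {X : Type*} [MetricSpace X] (xL xM : X) (T : ℝ≥0) (hT : 0 < T)
    (h : ∃ ε : ℝ≥0, 0 < ε ∧ (∃ n : ℕ, T = (n : ℝ≥0) * ε) ∧
      ∃ Ψ, IsDiscreteManStrategyManFirst xL xM ε Ψ ∧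
        ∀ l, IsPath xL l → ∀ t ≤ T, (ε : ℝ) < dist (Ψ l t) (l t)) :
    ∃ Ψ, IsManStrategy xL xM Ψ ∧
      ∀ l, IsPath xL l → ∀ t ≤ T, Ψ l t ≠ l t := by
  obtain ⟨ε, hε, -, Ψ, hΨ, hdist⟩ := h
  refine ⟨Ψ, hΨ.isManStrategy hε, fun l hl t ht => ?_⟩
  exact dist_pos.1 (ε.coe_nonneg.trans_lt (hdist l hl t ht))

end
end

section
/- Let X be a compact metric space with fixed starting points, and fix T > 0. Suppose that for every n ≥ 1 there exists a lion strategy Φ_n for the continuous bounded-time game such that for every man path m there is a time t ∈ [0,T] with d(Φ_n(m)(t), m(t)) < 1/n. Then there exists a winning lion strategy for the continuous bounded-time game: a lion strategy Φ such that for every man path m there is t ∈ [0,T] with Φ(m)(t) = m(t). -/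
/-!
Lemma 3 of the paper: in a compact metric space, if for every n there is a lion
strategy getting within distance 1/n of the man by time T, then the lion has a
winning strategy for the bounded-time game.
-/

open NNReal

noncomputable section

/-- A lion strategy for the continuous game: a no-lookahead map from man paths
to lion paths. -/
def IsLionStrategy {X : Type*} [MetricSpace X] (xL xM : X)
    (Φ : (ℝ≥0 → X) → (ℝ≥0 → X)) : Prop :=
  (∀ m, IsPath xM m → IsPath xL (Φ m)) ∧
  ∀ m m', IsPath xM m → IsPath xM m' → ∀ t : ℝ≥0,
    (∀ s ≤ t, m s = m' s) → ∀ s ≤ t, Φ m s = Φ m' s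

/-- Let `X` be compact. If for every `n ≥ 1` there is a lion strategy `Φₙ` such that for
every man path `m` there is `t ∈ [0,T]` with `dist (Φₙ m t) (m t) < 1/n`, then the lion
has a winning strategy for the bounded-time game with horizon `T`. -/
theorem lion_win_of_approx_strategies
    {X : Type*} [MetricSpace X] [CompactSpace X] (xL xM : X) (T : ℝ≥0) (hT : 0 < T)
    (h : ∀ n : ℕ, 0 < n → ∃ Φ, IsLionStrategy xL xM Φ ∧
      ∀ m, IsPath xM m → ∃ t ≤ T, dist (Φ m t) (m t) < 1 / (n : ℝ)) :
    ∃ Φ, IsLionStrategy xL xM Φ ∧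
      ∀ m, IsPath xM m → ∃ t ≤ T, Φ m t = m t := by
  choose Φ hΦ hclose using fun n : ℕ => h (n + 1) n.succ_pos
  let U : Ultrafilter ℕ := Filter.hyperfilter ℕ
  have hU : (U : Filter ℕ) ≤ Filter.atTop := Nat.hyperfilter_le_atTop
  have hlim : ∀ m t, ∃ x, Filter.Tendsto (fun n => Φ n m t) U (nhds x) := fun m t => by
    obtain ⟨x, -, hx⟩ := isCompact_univ.ultrafilter_le_nhds (U.map fun n => Φ n m t) (by simp)
    exact ⟨x, hx⟩
  choose Ψ hΨ using hlim
  refine ⟨Ψ, ⟨fun m hm => ⟨?_, ?_⟩, fun m m' hm hm' t hagree s hs => ?_⟩, fun m hm => ?_⟩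
  · refine tendsto_nhds_unique (hΨ m 0) ?_
    simp only [fun n => ((hΦ n).1 m hm).1, tendsto_const_nhds]
  · refine LipschitzWith.of_dist_le_mul fun s t => ?_
    exact le_of_tendsto' ((hΨ m s).dist (hΨ m t))
      fun n => ((hΦ n).1 m hm).2.dist_le_mul s t
  · refine tendsto_nhds_unique (hΨ m s) ?_
    simpa only [fun n => (hΦ n).2 m m' hm hm' t hagree s hs] using hΨ m' s
  · choose τ hτT hτ using fun n => hclose n m hm
    obtain ⟨t, ht, hτt⟩ := (isCompact_Icc (a := (0 : ℝ≥0)) (b := T)).ultrafilter_le_nhds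
      (U.map τ) (Filter.tendsto_principal.2 (.of_forall fun n => ⟨zero_le, hτT n⟩))
    have hτt : Filter.Tendsto τ U (nhds t) := hτt
    refine ⟨t, ht.2, dist_le_zero.1 ?_⟩
    have hinv : Filter.Tendsto (fun n : ℕ => 1 / ((n + 1 : ℕ) : ℝ)) U (nhds 0) := by
      simpa using (tendsto_one_div_add_atTop_nhds_zero_nat (𝕜 := ℝ)).mono_left hU
    have hdist : Filter.Tendsto (fun n => dist (τ n) t) U (nhds 0) :=
      tendsto_iff_dist_tendsto_zero.1 hτt
    have hbound := (hdist.add hinv).add hdist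
    simp only [add_zero] at hbound
    refine le_of_tendsto_of_tendsto' ((hΨ m t).dist tendsto_const_nhds) hbound fun n => ?_
    have h₁ := ((hΦ n).1 m hm).2.dist_le_mul t (τ n)
    have h₂ := hm.2.dist_le_mul (τ n) t
    rw [dist_comm t] at h₁
    simp only [NNReal.coe_one, one_mul] at h₁ h₂
    linarith [hτ n, dist_triangle4 (Φ n m t) (Φ n m (τ n)) (m (τ n)) (m t)]

end
end

section
/- Let X be a compact metric space with fixed starting points, and fix T > 0. Suppose that for every η > 0 there exist ε ∈ (0, η) with T = nε for some integer n, and a lion strategy in the ε-discrete bounded-time game (lion moving first) which guarantees that in every play the minimum distance between lion and man is less than η. Then the lion has a winning strategy for the continuous bounded-time game with horizon T. -/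
/-!
In a compact metric space, if for every η > 0 there is an ε ∈ (0,η) dividing T and an
ε-discrete lion strategy (lion moving first) guaranteeing minimum distance < η, then
the lion has a winning strategy for the continuous bounded-time game.
-/

open NNReal

noncomputable section

/-- A lion strategy for the ε-discrete game with the lion moving first: the lion's path
on the time block `[0,(k+1)ε]` depends only on the man's path on `[0,kε]`. -/
def IsDiscreteLionStrategyLionFirst {X : Type*} [MetricSpace X] (xL xM : X) (ε : ℝ≥0)
    (Φ : (ℝ≥0 → X) → (ℝ≥0 → X)) : Prop :=
  (∀ m, IsPath xM m → IsPath xL (Φ m)) ∧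
  ∀ m m', IsPath xM m → IsPath xM m' → ∀ k : ℕ,
    (∀ s ≤ (k : ℝ≥0) * ε, m s = m' s) →
    ∀ s ≤ ((k : ℝ≥0) + 1) * ε, Φ m s = Φ m' s

open Filter Topology

/-- In the discrete game with the lion moving first, strategies have no lookahead. -/
theorem IsDiscreteLionStrategyLionFirst.isLionStrategy {X : Type*} [MetricSpace X] {xL xM : X}
    {ε : ℝ≥0} (hε : 0 < ε) {Φ : (ℝ≥0 → X) → (ℝ≥0 → X)}
    (hΦ : IsDiscreteLionStrategyLionFirst xL xM ε Φ) : IsLionStrategy xL xM Φ := by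
  refine ⟨hΦ.1, fun m m' hm hm' t hagree s hs => ?_⟩
  refine hΦ.2 m m' hm hm' ⌊t / ε⌋₊ (fun r hr => hagree r (hr.trans ?_)) s (hs.trans ?_)
  · exact (le_div_iff₀ hε).1 (Nat.floor_le zero_le)
  · exact ((div_lt_iff₀ hε).1 (Nat.lt_floor_add_one (t / ε))).le

/-- The pointwise limit of a sequence of lion strategies along an ultrafilter. -/
def ultralimitStrategy {X : Type*} [MetricSpace X] (U : Ultrafilter ℕ)
    (Ψ : ℕ → (ℝ≥0 → X) → (ℝ≥0 → X)) (m : ℝ≥0 → X) (t : ℝ≥0) : X :=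
  (U.map fun k => Ψ k m t).lim

theorem tendsto_ultralimitStrategy {X : Type*} [MetricSpace X] [CompactSpace X]
    (U : Ultrafilter ℕ) (Ψ : ℕ → (ℝ≥0 → X) → (ℝ≥0 → X)) (m : ℝ≥0 → X) (t : ℝ≥0) :
    Tendsto (fun k => Ψ k m t) U (𝓝 (ultralimitStrategy U Ψ m t)) :=
  (U.map fun k => Ψ k m t).le_nhds_lim

theorem isLionStrategy_ultralimitStrategy {X : Type*} [MetricSpace X] [CompactSpace X]
    {xL xM : X} (U : Ultrafilter ℕ) {Ψ : ℕ → (ℝ≥0 → X) → (ℝ≥0 → X)}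
    (hΨ : ∀ k, IsLionStrategy xL xM (Ψ k)) :
    IsLionStrategy xL xM (ultralimitStrategy U Ψ) := by
  have hlim := tendsto_ultralimitStrategy U Ψ
  refine ⟨fun m hm => ⟨?_, LipschitzWith.of_dist_le_mul fun s t => ?_⟩,
    fun m m' hm hm' t hagree s hs => ?_⟩
  · exact tendsto_nhds_unique (hlim m 0)
      (tendsto_const_nhds.congr fun k => ((hΨ k).1 m hm).1.symm)
  · exact le_of_tendsto ((hlim m s).dist (hlim m t))
      (Eventually.of_forall fun k => ((hΨ k).1 m hm).2.dist_le_mul s t)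
  · exact tendsto_nhds_unique (hlim m s)
      ((hlim m' s).congr fun k => ((hΨ k).2 m m' hm hm' t hagree s hs).symm)

/-- Let `X` be compact. Suppose that for every `η > 0` there are `ε ∈ (0,η)` with
`T = nε` and an ε-discrete lion strategy (lion moving first) which in every play comes
within distance `η` of the man at some time in `[0,T]`. Then the lion has a winning
strategy for the continuous bounded-time game with horizon `T`. -/
theorem discrete_lion_win_implies_continuous_lion_win
    {X : Type*} [MetricSpace X] [CompactSpace X] (xL xM : X) (T : ℝ≥0) (hT : 0 < T)
    (h : ∀ η : ℝ, 0 < η → ∃ ε : ℝ≥0, 0 < ε ∧ (ε : ℝ) < η ∧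
      (∃ n : ℕ, T = (n : ℝ≥0) * ε) ∧
      ∃ Φ, IsDiscreteLionStrategyLionFirst xL xM ε Φ ∧
        ∀ m, IsPath xM m → ∃ t ≤ T, dist (Φ m t) (m t) < η) :
    ∃ Φ, IsLionStrategy xL xM Φ ∧
      ∀ m, IsPath xM m → ∃ t ≤ T, Φ m t = m t := by
  choose ε hε _ _ Φ hΦ hwin using fun k : ℕ => h (1 / ((k : ℝ) + 1)) Nat.one_div_pos_of_nat
  have hstrat : ∀ k, IsLionStrategy xL xM (Φ k) := fun k => (hΦ k).isLionStrategy (hε k)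
  let U : Ultrafilter ℕ := hyperfilter ℕ
  have hU : (U : Filter ℕ) ≤ atTop := Nat.hyperfilter_le_atTop
  refine ⟨ultralimitStrategy U Φ, isLionStrategy_ultralimitStrategy U hstrat, fun m hm => ?_⟩
  choose t ht hdist using fun k => hwin k m hm
  obtain ⟨τ, hτ, hUτ⟩ := (isCompact_Icc (a := (0 : ℝ≥0)) (b := T)).ultrafilter_le_nhds (U.map t)
    (tendsto_principal.2 (Eventually.of_forall fun k => ⟨zero_le, ht k⟩))
  have htτ : Tendsto t U (𝓝 τ) := hUτ
  refine ⟨τ, hτ.2, dist_le_zero.1 ?_⟩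
  have hdtτ : Tendsto (fun k => dist (t k) τ) U (𝓝 0) := tendsto_iff_dist_tendsto_zero.1 htτ
  have hbound : Tendsto (fun k => dist (t k) τ + 1 / ((k : ℝ) + 1) + dist (t k) τ) U (𝓝 0) := by
    simpa using (hdtτ.add (tendsto_one_div_add_atTop_nhds_zero_nat.mono_left hU)).add hdtτ
  refine le_of_tendsto_of_tendsto' ((tendsto_ultralimitStrategy U Φ m τ).dist tendsto_const_nhds)
    hbound fun k => ?_
  have hlion := ((hstrat k).1 m hm).2.dist_le_mul τ (t k)
  have hman := hm.2.dist_le_mul (t k) τ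
  rw [NNReal.coe_one, one_mul] at hlion hman
  rw [dist_comm τ] at hlion
  exact (dist_triangle4 _ _ _ _).trans (add_le_add_three hlion (hdist k).le hman)

end
end

section
/- Let X be a compact metric space with fixed starting points, fix T > 0, and suppose the man has a winning strategy Ψ for the bounded-time game with horizon T which is continuous as a map from the space L of lion paths to the space M of man paths (both equipped with the supremum metric). Then there is a constant c > 0 such that for every lion path l, inf_{t∈[0,T]} d(l(t), Ψ(l)(t)) ≥ c; in particular, in the ε-discrete game the man can guarantee distance at least c − ε, so that the discrete game value δ(ε) does not tend to 0 as ε → 0. -/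
/-!
In a compact metric space, if the man has a continuous winning strategy for the
bounded-time game, then the lion is kept at distance at least some c > 0; in
particular in the ε-discrete game (man first) the man can guarantee distance at
least c - ε, so the discrete game value does not tend to 0.
-/

open NNReal

noncomputable section

theorem isCompact_setOf_isPath {X : Type*} [MetricSpace X] [CompactSpace X] (x : X) :
    IsCompact {f : ℝ≥0 → X | IsPath x f} := by
  apply IsClosed.isCompact
  have h : {f : ℝ≥0 → X | IsPath x f} =
      {f | f 0 = x} ∩ ⋂ s, ⋂ t, {f : ℝ≥0 → X | dist (f s) (f t) ≤ dist s t} := by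
    ext f
    simp [IsPath, lipschitzWith_iff_dist_le_mul]
  rw [h]
  refine (isClosed_eq (continuous_apply 0) continuous_const).inter ?_
  exact isClosed_iInter fun s => isClosed_iInter fun t =>
    isClosed_le ((continuous_apply s).dist (continuous_apply t)) continuous_const

/-- On the set of paths, a pointwise neighbourhood controls the distance uniformly on `[0,T]`. -/
theorem eventually_forall_dist_le_of_isPath {X : Type*} [MetricSpace X] {x : X} {l : ℝ≥0 → X}
    (hl : IsPath x l) (T : ℝ≥0) {γ : ℝ} (hγ : 0 < γ) :
    ∀ᶠ l' in nhdsWithin l {f | IsPath x f}, ∀ t ≤ T, dist (l t) (l' t) ≤ γ := by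
  have key : ∀ᶠ l' in nhdsWithin l {f | IsPath x f},
      ∀ t ∈ Set.Icc 0 T, dist (l t) (l' t) ≤ γ := by
    refine isCompact_Icc.induction_on (p := fun S => ∀ᶠ l' in nhdsWithin l {f | IsPath x f},
      ∀ t ∈ S, dist (l t) (l' t) ≤ γ) (by simp) ?_ ?_ ?_
    · intro S S' hS h
      filter_upwards [h] with l' hl' t ht using hl' t (hS ht)
    · intro S S' h h'
      filter_upwards [h, h'] with l' h1 h2 t ht
      exact ht.elim (h1 t) (h2 t)
    · intro t _
      refine ⟨Metric.ball t (γ / 3),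
        mem_nhdsWithin_of_mem_nhds (Metric.ball_mem_nhds t (by positivity)), ?_⟩
      have hnear : ∀ᶠ l' : ℝ≥0 → X in nhdsWithin l {f | IsPath x f},
          dist (l' t) (l t) < γ / 3 :=
        nhdsWithin_le_nhds ((continuous_apply t).continuousAt.eventually
          (Metric.ball_mem_nhds (l t) (by positivity)))
      filter_upwards [hnear, self_mem_nhdsWithin] with l' h1 hl' s hs
      rw [Metric.mem_ball] at hs
      have h2 := hl.2.dist_le_mul s t
      have h3 := hl'.2.dist_le_mul t s
      have h4 := dist_triangle4 (l s) (l t) (l' t) (l' s)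
      rw [dist_comm (l' t)] at h1
      rw [dist_comm t] at h3
      simp only [NNReal.coe_one, one_mul] at h2 h3
      linarith
  filter_upwards [key] with l' h t ht using h t ⟨zero_le, ht⟩

theorem exists_pos_forall_le_dist_of_continuous_strategy
    {X : Type*} [MetricSpace X] [CompactSpace X] {xL xM : X} {T : ℝ≥0}
    {Ψ : (ℝ≥0 → X) → (ℝ≥0 → X)} (hΨ : ∀ l, IsPath xL l → IsPath xM (Ψ l))
    (hwin : ∀ l, IsPath xL l → ∀ t ≤ T, Ψ l t ≠ l t)
    (hcont : ∀ l, IsPath xL l → ∀ δ : ℝ, 0 < δ → ∃ γ : ℝ, 0 < γ ∧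
      ∀ l', IsPath xL l' → (∀ t ≤ T, dist (l t) (l' t) ≤ γ) →
        ∀ t ≤ T, dist (Ψ l t) (Ψ l' t) ≤ δ) :
    ∃ c : ℝ, 0 < c ∧ ∀ l, IsPath xL l → ∀ t ≤ T, c ≤ dist (l t) (Ψ l t) := by
  refine (isCompact_setOf_isPath xL).induction_on
    (p := fun S => ∃ c : ℝ, 0 < c ∧ ∀ l ∈ S, ∀ t ≤ T, c ≤ dist (l t) (Ψ l t))
    ⟨1, one_pos, by simp⟩ ?_ ?_ ?_
  · rintro S S' hS ⟨c, hc, h⟩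
    exact ⟨c, hc, fun l hl => h l (hS hl)⟩
  · rintro S S' ⟨c, hc, h⟩ ⟨c', hc', h'⟩
    refine ⟨min c c', lt_min hc hc', fun l hl t ht => ?_⟩
    exact hl.elim (fun hl => (min_le_left _ _).trans (h l hl t ht))
      (fun hl => (min_le_right _ _).trans (h' l hl t ht))
  · intro l hl
    obtain ⟨t₀, ht₀, hmin⟩ := (isCompact_Icc (a := (0 : ℝ≥0)) (b := T)).exists_isMinOn
      ⟨0, le_rfl, zero_le⟩ (hl.2.continuous.dist (hΨ l hl).2.continuous).continuousOn
    set m := dist (l t₀) (Ψ l t₀) with hm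
    have hmpos : 0 < m := dist_pos.2 (hwin l hl t₀ ht₀.2).symm
    obtain ⟨γ, hγ, hγΨ⟩ := hcont l hl (m / 3) (by positivity)
    refine ⟨{l' | IsPath xL l' ∧ ∀ t ≤ T, dist (l t) (l' t) ≤ min γ (m / 3)}, ?_, m / 3,
      by positivity, ?_⟩
    · filter_upwards [self_mem_nhdsWithin, eventually_forall_dist_le_of_isPath hl T
        (lt_min hγ (by positivity : 0 < m / 3))] with l' h1 h2 using ⟨h1, h2⟩
    · rintro l' ⟨hl', hd⟩ t ht
      have h1 : m ≤ dist (l t) (Ψ l t) := hmin ⟨zero_le, ht⟩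
      have h2 := (hd t ht).trans (min_le_right _ _)
      have h3 := hγΨ l' hl' (fun s hs => (hd s hs).trans (min_le_left _ _)) t ht
      have h4 := dist_triangle4 (l t) (l' t) (Ψ l' t) (Ψ l t)
      rw [dist_comm (Ψ l' t)] at h4
      linarith

theorem dist_self_tsub_le (ε t : ℝ≥0) : dist t (t - ε) ≤ ε := by
  rw [NNReal.dist_eq, abs_of_nonneg (sub_nonneg.2 (NNReal.coe_le_coe.2 tsub_le_self)),
    sub_le_iff_le_add]
  exact_mod_cast le_add_tsub (a := t) (b := ε)

theorem IsPath.delay {X : Type*} [MetricSpace X] {x : X} {l : ℝ≥0 → X}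
    (hl : IsPath x l) (ε : ℝ≥0) : IsPath x (fun t => l (t - ε)) := by
  refine ⟨by simpa using hl.1, LipschitzWith.of_dist_le_mul fun s t => ?_⟩
  refine (hl.2.dist_le_mul _ _).trans ?_
  gcongr
  rw [NNReal.dist_eq, NNReal.dist_eq, NNReal.coe_sub_def, NNReal.coe_sub_def]
  exact abs_max_sub_max_le_abs _ _ _ |>.trans_eq (by ring_nf)

/-- Playing a strategy against the lion delayed by `ε` gives an `ε`-discrete strategy. -/
theorem IsManStrategy.isDiscreteManStrategyManFirst_delay {X : Type*} [MetricSpace X]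
    {xL xM : X} {Ψ : (ℝ≥0 → X) → (ℝ≥0 → X)} (hΨ : IsManStrategy xL xM Ψ) (ε : ℝ≥0) :
    IsDiscreteManStrategyManFirst xL xM ε (fun l => Ψ fun t => l (t - ε)) := by
  refine ⟨fun l hl => hΨ.1 _ (hl.delay ε), fun l l' hl hl' k h => ?_⟩
  refine hΨ.2 _ _ (hl.delay ε) (hl'.delay ε) _ fun s hs => h _ ?_
  rwa [tsub_le_iff_right, ← add_one_mul]

/-- Suppose `X` is compact and `Ψ` is a man strategy, winning for the bounded-time game
with horizon `T`, which is continuous with respect to the supremum metric (over `[0,T]`)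
on paths. Then there is `c > 0` such that for every lion path the distance between lion
and man always stays at least `c` on `[0,T]`; in particular, for every `ε ∈ (0,c)`
dividing `T` the man has an ε-discrete strategy (man first) guaranteeing distance at
least `c - ε` throughout `[0,T]`. -/
theorem continuous_man_strategy_keeps_distance
    {X : Type*} [MetricSpace X] [CompactSpace X] (xL xM : X) (T : ℝ≥0) (hT : 0 < T)
    (Ψ : (ℝ≥0 → X) → (ℝ≥0 → X)) (hΨ : IsManStrategy xL xM Ψ)
    (hwin : ∀ l, IsPath xL l → ∀ t ≤ T, Ψ l t ≠ l t)
    (hcont : ∀ l, IsPath xL l → ∀ δ : ℝ, 0 < δ → ∃ γ : ℝ, 0 < γ ∧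
      ∀ l', IsPath xL l' → (∀ t ≤ T, dist (l t) (l' t) ≤ γ) →
        ∀ t ≤ T, dist (Ψ l t) (Ψ l' t) ≤ δ) :
    ∃ c : ℝ, 0 < c ∧
      (∀ l, IsPath xL l → ∀ t ≤ T, c ≤ dist (l t) (Ψ l t)) ∧
      ∀ ε : ℝ≥0, 0 < ε → (ε : ℝ) < c → (∃ n : ℕ, T = (n : ℝ≥0) * ε) →
        ∃ Ψ', IsDiscreteManStrategyManFirst xL xM ε Ψ' ∧
          ∀ l, IsPath xL l → ∀ t ≤ T, c - (ε : ℝ) ≤ dist (l t) (Ψ' l t) := by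
  obtain ⟨c, hc, h⟩ := exists_pos_forall_le_dist_of_continuous_strategy hΨ.1 hwin hcont
  refine ⟨c, hc, h, fun ε _ _ _ =>
    ⟨_, hΨ.isDiscreteManStrategyManFirst_delay ε, fun l hl t ht => ?_⟩⟩
  have h1 := h _ (hl.delay ε) t ht
  have h2 := (hl.2.dist_le_mul t (t - ε)).trans
    (mul_le_mul_of_nonneg_left (dist_self_tsub_le ε t) (NNReal.coe_nonneg 1))
  have h3 := dist_triangle_left (l (t - ε)) (Ψ (fun t => l (t - ε)) t) (l t)
  rw [NNReal.coe_one, one_mul] at h2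
  linarith

end
end

section
/- In the lion and man game on the closed unit disc D = {x ∈ ℝ² : |x| ≤ 1} with the lion starting at the origin, the man does not have a continuous winning strategy. Indeed, for any man strategy Ψ that is continuous as a map from lion paths to man paths (with the supremum metrics), there is a lion path l with Ψ(l)(1) = l(1), i.e. the lion catches the man by time 1. (The proof applies the Brouwer fixed point theorem to z ↦ Ψ(l_z)(1), where l_z is the constant-speed path from the origin reaching z at time 1.) -/
/-!
In the lion and man game on the closed unit disc with the lion starting at the origin,
the man has no continuous winning strategy: for any continuous man strategy there is a
lion path catching the man by time 1 (Brouwer fixed point argument).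
-/

open NNReal

noncomputable section

/-- A continuous self-map of the complex plane with values in the unit disc has a fixed point. -/
theorem Complex.exists_fixedPoint_of_norm_le_one {f : ℂ → ℂ} (hf : Continuous f)
    (hf1 : ∀ z, ‖f z‖ ≤ 1) : ∃ z, f z = z := by
  by_contra! hne
  obtain ⟨h, ⟨-, hh⟩, -⟩ := Complex.isCoveringMapOn_exp.existsUnique_continuousMap_lifts
    (⟨fun z => z - f z, by fun_prop⟩ : C(ℂ, ℂ)) (a₀ := 0)
    (Complex.exp_log (sub_ne_zero.2 (hne 0).symm)) (fun z => sub_ne_zero.2 (hne z).symm)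
  replace hh (z : ℂ) : Complex.exp (h z) = z - f z := congrFun hh z
  set w : ℝ → ℂ := fun θ => Complex.exp (θ * Complex.I) with hw
  set q : ℝ → ℂ := fun θ => 2 - Complex.exp (-(θ * Complex.I)) * f (2 * w θ) with hq
  have hw_period : w (2 * Real.pi) = w 0 := by simp [hw]
  have hq_period : q (2 * Real.pi) = q 0 := by
    simp [hq, hw_period, Complex.exp_neg]
  have hq_slit (θ : ℝ) : q θ ∈ Complex.slitPlane := by
    refine Or.inl ?_
    have hn : ‖Complex.exp (-(θ * Complex.I)) * f (2 * w θ)‖ ≤ 1 := by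
      rw [norm_mul, ← neg_mul, ← Complex.ofReal_neg, Complex.norm_exp_ofReal_mul_I, one_mul]
      exact hf1 _
    have hre := (Complex.re_le_norm _).trans hn
    simp only [hq, Complex.sub_re, Complex.re_ofNat]
    linarith
  have hq_cont : Continuous q := by fun_prop
  have hlog_cont : Continuous fun θ => Complex.log (q θ) := hq_cont.clog hq_slit
  have hwq (θ : ℝ) : w θ * q θ = 2 * w θ - f (2 * w θ) := by
    simp only [hq, mul_sub, ← mul_assoc]
    rw [hw, ← Complex.exp_add]
    simp [mul_comm]
  have hexp (θ : ℝ) : Complex.exp (h (2 * w θ)) = w θ * q θ := by rw [hh, hwq]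
  have hexp' (θ : ℝ) : Complex.exp (θ * Complex.I + Complex.log (q θ)) = w θ * q θ := by
    rw [Complex.exp_add, Complex.exp_log (Complex.slitPlane_ne_zero (hq_slit θ))]
  have hc : Complex.exp (h (2 * w 0) - Complex.log (q 0)) = 1 := by
    rw [Complex.exp_sub, hexp, Complex.exp_log (Complex.slitPlane_ne_zero (hq_slit 0)),
      div_eq_one_iff_eq (Complex.slitPlane_ne_zero (hq_slit 0))]
    simp [hw]
  have heq : (fun θ : ℝ => h (2 * w θ)) = fun θ : ℝ =>
      θ * Complex.I + Complex.log (q θ) + (h (2 * w 0) - Complex.log (q 0)) := by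
    refine Complex.isCoveringMap_exp.eq_of_comp_eq (by fun_prop) (by fun_prop) ?_ 0 (by simp)
    ext θ
    simp only [Function.comp_apply]
    rw [Complex.exp_add, hc, mul_one, hexp, hexp']
  have h2π := congrFun heq (2 * Real.pi)
  simp only [hw_period, hq_period] at h2π
  exact Complex.two_pi_I_ne_zero (by push_cast at h2π; linear_combination -h2π)

/-- A continuous self-map of the Euclidean plane with values in the unit disc has a fixed point. -/
theorem exists_fixedPoint_of_norm_le_one {f : E2 → E2} (hf : Continuous f)
    (hf1 : ∀ z, ‖f z‖ ≤ 1) : ∃ z, f z = z := by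
  let e := Complex.orthonormalBasisOneI.repr
  obtain ⟨z, hz⟩ := Complex.exists_fixedPoint_of_norm_le_one (f := fun z => e.symm (f (e z)))
    (by fun_prop) (fun z => by simpa using hf1 (e z))
  exact ⟨e z, by simpa using congrArg e hz⟩

/-- The radial map of the plane onto the closed unit disc, the identity on the disc. -/
def discProj (z : E2) : E2 := (max 1 ‖z‖)⁻¹ • z

theorem continuous_discProj : Continuous discProj := by
  unfold discProj
  exact ((continuous_const.max continuous_norm).inv₀ fun z =>
    (lt_max_of_lt_left one_pos).ne').smul continuous_id

theorem norm_discProj_le_one (z : E2) : ‖discProj z‖ ≤ 1 := by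
  have h : 0 < max 1 ‖z‖ := lt_max_of_lt_left one_pos
  rw [discProj, norm_smul, norm_inv, Real.norm_of_nonneg h.le, inv_mul_le_one₀ h]
  exact le_max_right _ _

theorem discProj_of_norm_le_one {z : E2} (hz : ‖z‖ ≤ 1) : discProj z = z := by
  simp [discProj, max_eq_left hz]

/-- The constant-speed path from the origin that reaches `discProj z` at time `1` and then stays
there. -/
def radialPath (z : E2) (t : ℝ≥0) : E2 := min (t : ℝ) 1 • discProj z

theorem radialPath_isPathIn (z : E2) : IsPathIn Disc 0 (radialPath z) := by
  refine ⟨by simp [radialPath], LipschitzWith.of_dist_le_mul fun s t => ?_, fun t => ?_⟩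
  · rw [radialPath, radialPath, dist_eq_norm, ← sub_smul, norm_smul, NNReal.coe_one, one_mul,
      NNReal.dist_eq, Real.norm_eq_abs]
    refine (mul_le_of_le_one_right (abs_nonneg _) (norm_discProj_le_one z)).trans ?_
    exact (abs_min_sub_min_le_max _ _ _ _).trans (by simp)
  · rw [Disc, mem_closedBall_zero_iff, radialPath, norm_smul,
      Real.norm_of_nonneg (le_min t.coe_nonneg zero_le_one)]
    exact mul_le_one₀ (min_le_right _ _) (norm_nonneg _) (norm_discProj_le_one z)

theorem dist_radialPath_le (z w : E2) (t : ℝ≥0) :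
    dist (radialPath z t) (radialPath w t) ≤ dist (discProj z) (discProj w) := by
  rw [radialPath, radialPath, dist_smul₀, Real.norm_of_nonneg (le_min t.coe_nonneg zero_le_one)]
  exact mul_le_of_le_one_left dist_nonneg (min_le_right _ _)

/-- In the lion and man game in the closed unit disc with the lion starting at the
origin, for any man strategy `Ψ` that is continuous with respect to the supremum
metric on paths, there is a lion path `l` with `Ψ l 1 = l 1`: the lion catches the
man by time 1.  In particular the man has no continuous winning strategy. -/
theorem no_continuous_winning_man_strategy_in_disc
    (xM : E2) (hM : xM ∈ Disc) (hne : xM ≠ 0)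
    (Ψ : (ℝ≥0 → E2) → (ℝ≥0 → E2)) (hΨ : IsManStrategyIn Disc 0 xM Ψ)
    (hcont : ∀ l, IsPathIn Disc 0 l → ∀ δ : ℝ, 0 < δ → ∃ γ : ℝ, 0 < γ ∧
      ∀ l', IsPathIn Disc 0 l' → (∀ t, dist (l t) (l' t) ≤ γ) →
        ∀ t, dist (Ψ l t) (Ψ l' t) ≤ δ) :
    ∃ l, IsPathIn Disc 0 l ∧ Ψ l 1 = l 1 := by
  have hpath (z : E2) : IsPathIn Disc 0 (radialPath z) := radialPath_isPathIn z
  have hF : Continuous fun z => Ψ (radialPath z) 1 := by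
    refine continuous_iff_continuousAt.2 fun z => Metric.continuousAt_iff.2 fun ε hε => ?_
    obtain ⟨γ, hγ, h⟩ := hcont _ (hpath z) (ε / 2) (half_pos hε)
    obtain ⟨η, hη, hη'⟩ := Metric.continuous_iff.1 continuous_discProj z γ hγ
    refine ⟨η, hη, fun {w} hw => ?_⟩
    rw [dist_comm]
    refine (h _ (hpath w) (fun t => ?_) 1).trans_lt (half_lt_self hε)
    exact (dist_radialPath_le z w t).trans (by rw [dist_comm]; exact (hη' w hw).le)
  have hF1 (z : E2) : Ψ (radialPath z) 1 ∈ Disc := (hΨ.1 _ (hpath z)).2.2 1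
  obtain ⟨z, hz⟩ := exists_fixedPoint_of_norm_le_one hF fun z => by
    simpa [Disc] using hF1 z
  have hz1 : ‖z‖ ≤ 1 := by simpa [Disc, hz] using hF1 z
  exact ⟨_, hpath z, by rw [hz]; simp [radialPath, discProj_of_norm_le_one hz1]⟩

end
end

section
/- Let X be the closed unit ball of l_∞²: the square [−1,1]² with metric d((x,y),(x′,y′)) = max(|x−x′|, |y−y′|). Then for any distinct starting positions, both players have winning strategies in the lion and man game on X: the lion has a strategy guaranteeing capture by time 2, and the man has a strategy guaranteeing he is never caught at any time t ∈ [0,∞). -/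
/-!
On the closed unit ball of l_∞² (the square [-1,1]² with the max metric), both players
have winning strategies from any distinct starting positions.  (Note: in Mathlib the
metric on `ℝ × ℝ` is the max metric, i.e. exactly l_∞².)
-/

open NNReal

noncomputable section

/-- The closed unit ball of `l_∞²`: the square `[-1,1] × [-1,1]` inside `ℝ × ℝ`,
whose product metric is `dist ((x,y),(x',y')) = max |x - x'| |y - y'|`. -/
def SqBall : Set (ℝ × ℝ) := Set.Icc (-1 : ℝ) 1 ×ˢ Set.Icc (-1 : ℝ) 1

open Set Filter Topology

/-- The lion's coordinate: stay as close to `f t` as the interval `[x - t, x + t]` allows. -/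
def chase (x : ℝ) (f : ℝ≥0 → ℝ) (t : ℝ≥0) : ℝ := max (x - t) (min (x + t) (f t))

theorem chase_zero (x : ℝ) (f : ℝ≥0 → ℝ) : chase x f 0 = x := by
  simp [chase]

theorem lipschitzWith_coe_real : LipschitzWith 1 (fun t : ℝ≥0 => (t : ℝ)) :=
  LipschitzWith.subtype_val _

theorem lipschitzWith_chase (x : ℝ) {f : ℝ≥0 → ℝ} (hf : LipschitzWith 1 f) :
    LipschitzWith 1 (chase x f) := by
  have h1 : LipschitzWith 1 (fun t : ℝ≥0 => x - (t : ℝ)) := by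
    simpa using (LipschitzWith.const x).sub lipschitzWith_coe_real
  have h2 : LipschitzWith 1 (fun t : ℝ≥0 => x + (t : ℝ)) := by
    simpa using (LipschitzWith.const x).add lipschitzWith_coe_real
  have h3 := h1.max (h2.min hf)
  rwa [max_self, max_self] at h3

theorem chase_mem_Icc {x : ℝ} {f : ℝ≥0 → ℝ} {t : ℝ≥0} (hx : x ∈ Icc (-1 : ℝ) 1)
    (hf : f t ∈ Icc (-1 : ℝ) 1) : chase x f t ∈ Icc (-1 : ℝ) 1 := by
  have ht : (0 : ℝ) ≤ t := t.2
  refine ⟨le_max_of_le_right (le_min ?_ hf.1), max_le ?_ (min_le_of_right_le hf.2)⟩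
  · linarith [hx.1]
  · linarith [hx.2]

theorem chase_two {x : ℝ} {f : ℝ≥0 → ℝ} (hx : x ∈ Icc (-1 : ℝ) 1)
    (hf : f 2 ∈ Icc (-1 : ℝ) 1) : chase x f 2 = f 2 := by
  have h2 : ((2 : ℝ≥0) : ℝ) = 2 := by norm_num
  rw [chase, h2, min_eq_right (by linarith [hx.1, hf.2]),
    max_eq_right (by linarith [hx.2, hf.1])]

/-- The distance to the nearest natural multiple of `p`, with sign `s k` on the interval
between `k * p` and `(k + 1) * p`. -/
def zigzag (s : ℕ → ℝ) (p u : ℝ) : ℝ :=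
  s ⌊u / p⌋₊ * Metric.infDist u (range fun k : ℕ => (k : ℝ) * p)

theorem infDist_multiples_le (p u : ℝ) (k : ℕ) :
    Metric.infDist u (range fun k : ℕ => (k : ℝ) * p) ≤ |u - k * p| := by
  simpa [Real.dist_eq] using
    Metric.infDist_le_dist_of_mem (x := u) (mem_range_self (f := fun k : ℕ => (k : ℝ) * p) k)

theorem floor_div_bounds {p u : ℝ} (hp : 0 < p) (hu : 0 ≤ u) :
    (⌊u / p⌋₊ : ℝ) * p ≤ u ∧ u < (⌊u / p⌋₊ + 1) * p := by
  constructor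
  · rw [← le_div_iff₀ hp]
    exact Nat.floor_le (by positivity)
  · rw [← div_lt_iff₀ hp]
    exact Nat.lt_floor_add_one _

theorem abs_zigzag {s : ℕ → ℝ} (hs : ∀ k, |s k| = 1) (p u : ℝ) :
    |zigzag s p u| = Metric.infDist u (range fun k : ℕ => (k : ℝ) * p) := by
  rw [zigzag, abs_mul, hs, one_mul, abs_of_nonneg Metric.infDist_nonneg]

theorem abs_zigzag_sub_le {s : ℕ → ℝ} (hs : ∀ k, |s k| = 1) {p u v : ℝ} (hp : 0 < p)
    (hu : 0 ≤ u) (huv : u ≤ v) : |zigzag s p u - zigzag s p v| ≤ v - u := by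
  rcases (Nat.floor_mono (div_le_div_of_nonneg_right huv hp.le)).eq_or_lt with h | h
  · rw [zigzag, zigzag, h, ← mul_sub, abs_mul, hs, one_mul]
    have := (Metric.lipschitz_infDist_pt (range fun k : ℕ => (k : ℝ) * p)).dist_le_mul u v
    rw [Real.dist_eq, Real.dist_eq, abs_sub_comm u v, abs_of_nonneg (sub_nonneg.2 huv)] at this
    simpa using this
  · have hk : ((⌊u / p⌋₊ : ℝ) + 1) ≤ ⌊v / p⌋₊ := by exact_mod_cast h
    have h1 := (floor_div_bounds hp hu).2
    have h2 := (floor_div_bounds hp (hu.trans huv)).1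
    have h3 := mul_le_mul_of_nonneg_right hk hp.le
    have h4 := infDist_multiples_le p u ⌊v / p⌋₊
    have h5 := infDist_multiples_le p v ⌊v / p⌋₊
    rw [abs_of_nonpos (by linarith)] at h4
    rw [abs_of_nonneg (by linarith)] at h5
    have h6 := abs_sub (zigzag s p u) (zigzag s p v)
    rw [abs_zigzag hs, abs_zigzag hs] at h6
    linarith

theorem abs_zigzag_le {s : ℕ → ℝ} (hs : ∀ k, |s k| = 1) {p u : ℝ} (hp : 0 < p)
    (hu : 0 ≤ u) : |zigzag s p u| ≤ p / 2 := by
  rw [abs_zigzag hs]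
  obtain ⟨h1, h2⟩ := floor_div_bounds hp hu
  have h3 := infDist_multiples_le p u ⌊u / p⌋₊
  have h4 := infDist_multiples_le p u (⌊u / p⌋₊ + 1)
  push_cast at h4
  rw [abs_of_nonneg (by linarith)] at h3
  rw [abs_of_nonpos (by linarith)] at h4
  linarith

theorem zigzag_natCast_mul (s : ℕ → ℝ) (p : ℝ) (k : ℕ) : zigzag s p (k * p) = 0 := by
  rw [zigzag, Metric.infDist_zero_of_mem (s := range fun k : ℕ => (k : ℝ) * p) ⟨k, rfl⟩, mul_zero]

theorem zigzag_natCast_mul_add (s : ℕ → ℝ) {p r : ℝ} (k : ℕ) (hr : 0 < r) (hrp : r ≤ p / 2) :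
    zigzag s p (k * p + r) = s k * r := by
  have hp : 0 < p := by linarith
  have hfloor : ⌊(k * p + r) / p⌋₊ = k := by
    rw [Nat.floor_eq_iff (by positivity), le_div_iff₀ hp, div_lt_iff₀ hp]
    constructor <;> linarith
  rw [zigzag, hfloor]
  congr 1
  apply le_antisymm
  · have := infDist_multiples_le p (k * p + r) k
    rwa [add_sub_cancel_left, abs_of_pos hr] at this
  · rw [Metric.le_infDist (range_nonempty _)]
    rintro _ ⟨j, rfl⟩
    rw [Real.dist_eq]
    rcases le_or_gt j k with h | h
    · have hjk : (j : ℝ) ≤ k := by exact_mod_cast h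
      have := mul_le_mul_of_nonneg_right hjk hp.le
      exact le_trans (by linarith) (le_abs_self _)
    · have hjk : (k : ℝ) + 1 ≤ j := by exact_mod_cast h
      have := mul_le_mul_of_nonneg_right hjk hp.le
      exact le_trans (by linarith) (neg_le_abs _)

open Classical in
/-- The direction in which to leave `c` at time `T` so as not to meet `f`. -/
def awaySign (f : ℝ≥0 → ℝ) (c : ℝ) (T : ℝ≥0) : ℝ :=
  if ∀ᶠ r : ℝ≥0 in 𝓝[>] T, c + ((r : ℝ) - T) ≤ f r then -1 else 1

theorem abs_awaySign (f : ℝ≥0 → ℝ) (c : ℝ) (T : ℝ≥0) : |awaySign f c T| = 1 := by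
  unfold awaySign
  split_ifs <;> simp

theorem awaySign_congr {f g : ℝ≥0 → ℝ} {T t : ℝ≥0} (c : ℝ) (hT : T < t)
    (h : ∀ s ≤ t, f s = g s) : awaySign f c T = awaySign g c T := by
  have heq : (∀ᶠ r : ℝ≥0 in 𝓝[>] T, c + ((r : ℝ) - T) ≤ f r) ↔
      ∀ᶠ r : ℝ≥0 in 𝓝[>] T, c + ((r : ℝ) - T) ≤ g r := by
    apply eventually_congr
    filter_upwards [Ioc_mem_nhdsGT hT] with r hr
    rw [h r hr.2]
  classical exact if_congr heq rfl rfl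

theorem abs_sub_le_of_lipschitzWith {f : ℝ≥0 → ℝ} (hf : LipschitzWith 1 f) {r t : ℝ≥0}
    (hrt : r ≤ t) : |f t - f r| ≤ t - r := by
  have := hf.dist_le_mul t r
  rwa [NNReal.coe_one, one_mul, Real.dist_eq, NNReal.dist_eq,
    abs_of_nonneg (sub_nonneg.2 (NNReal.coe_le_coe.2 hrt))] at this

theorem ne_add_awaySign_mul {f : ℝ≥0 → ℝ} (hf : LipschitzWith 1 f) (c : ℝ) {T t : ℝ≥0}
    (hT : T < t) : c + awaySign f c T * ((t : ℝ) - T) ≠ f t := by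
  unfold awaySign
  split_ifs with h
  · obtain ⟨r, hr, hTr, hrt⟩ := (h.and (Ioc_mem_nhdsGT hT)).exists
    have h1 := (abs_le.1 (abs_sub_le_of_lipschitzWith hf hrt)).1
    have h2 : (T : ℝ) < r := NNReal.coe_lt_coe.2 hTr
    intro h3
    linarith
  · obtain ⟨r, hr, hTr, hrt⟩ :=
      ((Filter.not_eventually.1 h).and_eventually (Ioc_mem_nhdsGT hT)).exists
    have h1 := (abs_le.1 (abs_sub_le_of_lipschitzWith hf hrt)).2
    intro h3
    linarith

/-- A coordinate of the man: move from `x` to `(1 - δ) * x` during `[0, δ]`, wait until time `A`,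
and from then on repeatedly run away from `f` for time `δ` and come back. -/
def evade (δ A : ℝ≥0) (x : ℝ) (f : ℝ≥0 → ℝ) (t : ℝ≥0) : ℝ :=
  (1 - (min t δ : ℝ≥0)) * x +
    zigzag (fun k => awaySign f ((1 - δ) * x) (A + k * (2 * δ))) (2 * δ) (t - A : ℝ≥0)

theorem zigzag_zero (s : ℕ → ℝ) (p : ℝ) : zigzag s p 0 = 0 := by
  simpa using zigzag_natCast_mul s p 0

theorem evade_of_le {δ A : ℝ≥0} (x : ℝ) (f : ℝ≥0 → ℝ) {t : ℝ≥0} (h : t ≤ A) :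
    evade δ A x f t = (1 - (min t δ : ℝ≥0)) * x := by
  rw [evade, tsub_eq_zero_of_le h, NNReal.coe_zero, zigzag_zero, add_zero]

theorem evade_zero (δ A : ℝ≥0) (x : ℝ) (f : ℝ≥0 → ℝ) : evade δ A x f 0 = x := by
  simp [evade_of_le]

theorem evade_mem_Icc {δ A : ℝ≥0} {x : ℝ} (f : ℝ≥0 → ℝ) (t : ℝ≥0) (hδ : 0 < δ) (hδ1 : δ ≤ 1)
    (hA : δ ≤ A) (hx : x ∈ Icc (-1 : ℝ) 1) : evade δ A x f t ∈ Icc (-1 : ℝ) 1 := by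
  have hδ' : (0 : ℝ) < δ := hδ
  have hδ1' : (δ : ℝ) ≤ 1 := hδ1
  have hx' : |x| ≤ 1 := abs_le.2 hx
  rw [mem_Icc, ← abs_le]
  rcases le_total t A with h | h
  · rw [evade_of_le x f h, abs_mul]
    have h0 : (0 : ℝ) ≤ (min t δ : ℝ≥0) := NNReal.coe_nonneg _
    have h1 : ((min t δ : ℝ≥0) : ℝ) ≤ δ := NNReal.coe_le_coe.2 (min_le_right _ _)
    have h2 : |1 - ((min t δ : ℝ≥0) : ℝ)| ≤ 1 := abs_le.2 ⟨by linarith, by linarith⟩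
    exact mul_le_one₀ h2 (abs_nonneg _) hx'
  · rw [evade, min_eq_right (hA.trans h)]
    refine (abs_add_le _ _).trans ?_
    have h1 := abs_zigzag_le (s := fun k => awaySign f ((1 - δ) * x) (A + k * (2 * δ)))
      (fun k => abs_awaySign _ _ _) (p := 2 * δ) (by positivity) (t - A : ℝ≥0).2
    have h2 : |(1 - (δ : ℝ)) * x| ≤ 1 - δ := by
      rw [abs_mul, abs_of_nonneg (by linarith)]
      exact mul_le_of_le_one_right (by linarith) hx'
    rw [NNReal.val_eq_coe] at h1
    linarith

theorem lipschitzWith_evade {δ A : ℝ≥0} {x : ℝ} (f : ℝ≥0 → ℝ) (hδ : 0 < δ)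
    (hA : δ ≤ A) (hx : x ∈ Icc (-1 : ℝ) 1) : LipschitzWith 1 (evade δ A x f) := by
  have key : ∀ a b : ℝ≥0, a ≤ b → |evade δ A x f a - evade δ A x f b| ≤ b - a := by
    intro a b hab
    have hp : (0 : ℝ) < 2 * δ := by positivity
    have h1 := abs_zigzag_sub_le (s := fun k => awaySign f ((1 - δ) * x) (A + k * (2 * δ)))
      (fun k => abs_awaySign _ _ _) hp (NNReal.coe_nonneg (a - A))
      (NNReal.coe_le_coe.2 (tsub_le_tsub_right hab A))
    have h2 : |(1 - ((min a δ : ℝ≥0) : ℝ)) * x - (1 - ((min b δ : ℝ≥0) : ℝ)) * x| ≤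
        (min b δ : ℝ≥0) - (min a δ : ℝ≥0) := by
      have h3 : ((min a δ : ℝ≥0) : ℝ) ≤ (min b δ : ℝ≥0) :=
        NNReal.coe_le_coe.2 (min_le_min_right δ hab)
      rw [← sub_mul, abs_mul, sub_sub_sub_cancel_left, abs_of_nonneg (sub_nonneg.2 h3)]
      exact mul_le_of_le_one_right (sub_nonneg.2 h3) (abs_le.2 hx)
    have h3 : ((min b δ : ℝ≥0) : ℝ) - (min a δ : ℝ≥0) + ((b - A : ℝ≥0) - (a - A : ℝ≥0)) ≤
        b - a := by
      have hA' : (δ : ℝ) ≤ A := hA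
      have hab' : (a : ℝ) ≤ b := hab
      rw [NNReal.coe_sub_def, NNReal.coe_sub_def, NNReal.coe_min, NNReal.coe_min]
      rcases min_cases (b : ℝ) (δ : ℝ) with h | h <;>
        rcases min_cases (a : ℝ) (δ : ℝ) with h' | h' <;>
        rcases max_cases ((b : ℝ) - A) 0 with h'' | h'' <;>
        rcases max_cases ((a : ℝ) - A) 0 with h4 | h4 <;> linarith
    rw [evade, evade, add_sub_add_comm]
    exact (abs_add_le _ _).trans (by linarith)
  refine LipschitzWith.of_dist_le_mul fun a b => ?_
  rw [NNReal.coe_one, one_mul, Real.dist_eq, NNReal.dist_eq]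
  rcases le_total a b with h | h
  · exact (key a b h).trans (by rw [abs_sub_comm]; exact le_abs_self _)
  · rw [abs_sub_comm]
    exact (key b a h).trans (le_abs_self _)

theorem evade_congr {δ A : ℝ≥0} (x : ℝ) {f g : ℝ≥0 → ℝ} {s : ℝ≥0} (hδ : 0 < δ)
    (h : ∀ r ≤ s, f r = g r) : evade δ A x f s = evade δ A x g s := by
  have hp : (0 : ℝ) < 2 * δ := by positivity
  rw [evade, evade]
  congr 1
  set u : ℝ≥0 := s - A with hu
  rcases (floor_div_bounds hp (NNReal.coe_nonneg u)).1.eq_or_lt with h1 | h1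
  · rw [← h1, zigzag_natCast_mul, zigzag_natCast_mul]
  · have h2 : ((⌊(u : ℝ) / (2 * δ)⌋₊ : ℝ≥0) * (2 * δ)) < u := by
      rw [← NNReal.coe_lt_coe]
      push_cast
      exact h1
    have h3 : A + (⌊(u : ℝ) / (2 * δ)⌋₊ : ℝ≥0) * (2 * δ) < s := by
      rw [add_comm]
      exact lt_tsub_iff_right.1 (hu ▸ h2)
    rw [zigzag, zigzag, awaySign_congr _ h3 h]

theorem evade_ne {δ A : ℝ≥0} (x : ℝ) {f : ℝ≥0 → ℝ} (hf : LipschitzWith 1 f) (hA : δ ≤ A)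
    {t : ℝ≥0} (k : ℕ) (h1 : A + k * (2 * δ) < t) (h2 : t ≤ A + k * (2 * δ) + δ) :
    evade δ A x f t ≠ f t := by
  have hAt : A ≤ t := le_self_add.trans h1.le
  have h1' : (A : ℝ) + k * (2 * δ) < t := by exact_mod_cast h1
  have h2' : (t : ℝ) ≤ A + k * (2 * δ) + δ := by exact_mod_cast h2
  have h3 : ((t - A : ℝ≥0) : ℝ) = k * (2 * δ) + (t - (A + k * (2 * δ))) := by
    rw [NNReal.coe_sub hAt]
    ring
  rw [evade, min_eq_right (hA.trans hAt), h3,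
    zigzag_natCast_mul_add _ k (by linarith) (by linarith)]
  have := ne_add_awaySign_mul hf ((1 - δ) * x) h1
  push_cast at this
  exact this

theorem exists_mul_lt_le {δ t : ℝ≥0} (hδ : 0 < δ) (ht : δ < t) :
    ∃ k : ℕ, (δ + k * (2 * δ) < t ∧ t ≤ δ + k * (2 * δ) + δ) ∨
      (2 * δ + k * (2 * δ) < t ∧ t ≤ 2 * δ + k * (2 * δ) + δ) := by
  have h1 := Nat.ceil_lt_add_one (a := (t - δ) / δ) zero_le
  have h2 := Nat.le_ceil ((t - δ) / δ)
  have h0 : 0 < ⌈(t - δ) / δ⌉₊ := Nat.ceil_pos.2 (div_pos (tsub_pos_of_lt ht) hδ)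
  obtain ⟨n, hn⟩ := Nat.exists_eq_succ_of_ne_zero h0.ne'
  have hδ' : (0 : ℝ) < δ := hδ
  rw [hn, ← NNReal.coe_lt_coe] at h1
  rw [hn, ← NNReal.coe_le_coe] at h2
  push_cast [NNReal.coe_sub ht.le] at h1 h2
  rw [div_le_iff₀ hδ'] at h2
  have h1 := (lt_div_iff₀ hδ').1 (lt_of_add_lt_add_right h1)
  simp only [← NNReal.coe_lt_coe, ← NNReal.coe_le_coe]
  rcases n.even_or_odd' with ⟨k, rfl | rfl⟩ <;> refine ⟨k, ?_⟩ <;> push_cast at h1 h2 ⊢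
  · left
    constructor <;> linarith
  · right
    constructor <;> linarith

theorem lipschitzWith_fst_comp {f : ℝ≥0 → ℝ × ℝ} (hf : LipschitzWith 1 f) :
    LipschitzWith 1 fun t => (f t).1 := by
  simpa [Function.comp_def] using LipschitzWith.prod_fst.comp hf

theorem lipschitzWith_snd_comp {f : ℝ≥0 → ℝ × ℝ} (hf : LipschitzWith 1 f) :
    LipschitzWith 1 fun t => (f t).2 := by
  simpa [Function.comp_def] using LipschitzWith.prod_snd.comp hf

theorem lipschitzWith_one_prodMk {f g : ℝ≥0 → ℝ} (hf : LipschitzWith 1 f)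
    (hg : LipschitzWith 1 g) : LipschitzWith 1 fun t => (f t, g t) := by
  simpa using hf.prodMk hg

theorem IsPathIn.ne_of_add_lt_dist {E : Type*} [MetricSpace E] {S : Set E} {x y : E}
    {f g : ℝ≥0 → E} (hf : IsPathIn S x f) (hg : IsPathIn S y g) {t : ℝ≥0}
    (h : (t : ℝ) + t < dist x y) : f t ≠ g t := by
  intro hfg
  have h1 := hf.2.1.dist_le_mul 0 t
  have h2 := hg.2.1.dist_le_mul t 0
  rw [hf.1] at h1
  rw [hg.1, ← hfg] at h2
  have h3 := dist_triangle x (f t) y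
  simp only [NNReal.dist_eq, NNReal.coe_zero, NNReal.coe_one, zero_sub, sub_zero, abs_neg,
    NNReal.abs_eq, one_mul] at h1 h2
  linarith

theorem exists_winning_lion_strategy {xL xM : ℝ × ℝ} (hL : xL ∈ SqBall) :
    ∃ Φ, IsLionStrategyIn SqBall xL xM Φ ∧
      ∀ m, IsPathIn SqBall xM m → ∃ t : ℝ≥0, t ≤ 2 ∧ Φ m t = m t := by
  refine ⟨fun m t => (chase xL.1 (fun s => (m s).1) t, chase xL.2 (fun s => (m s).2) t),
    ⟨fun m hm => ⟨?_, ?_, fun t => ?_⟩, fun m m' _ _ t h s hs => ?_⟩,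
    fun m hm => ⟨2, le_rfl, ?_⟩⟩
  · simp only [chase_zero]
  · exact lipschitzWith_one_prodMk (lipschitzWith_chase _ (lipschitzWith_fst_comp hm.2.1))
      (lipschitzWith_chase _ (lipschitzWith_snd_comp hm.2.1))
  · exact ⟨chase_mem_Icc (f := fun s => (m s).1) hL.1 (hm.2.2 t).1,
      chase_mem_Icc (f := fun s => (m s).2) hL.2 (hm.2.2 t).2⟩
  · simp only [chase, h s hs]
  · exact Prod.ext (chase_two (f := fun s => (m s).1) hL.1 (hm.2.2 2).1)
      (chase_two (f := fun s => (m s).2) hL.2 (hm.2.2 2).2)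

theorem exists_winning_man_strategy {xL xM : ℝ × ℝ} (hL : xL ∈ SqBall) (hM : xM ∈ SqBall)
    (hne : xL ≠ xM) :
    ∃ Ψ, IsManStrategyIn SqBall xL xM Ψ ∧
      ∀ l, IsPathIn SqBall xL l → ∀ t : ℝ≥0, Ψ l t ≠ l t := by
  obtain ⟨δ, hδdist⟩ : ∃ δ : ℝ≥0, (δ : ℝ) = dist xL xM / 4 := ⟨nndist xL xM / 4, by simp⟩
  have hdist : 0 < dist xL xM := dist_pos.2 hne
  have hδ : 0 < δ := by
    rw [← NNReal.coe_pos]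
    linarith
  have hδ1 : δ ≤ 1 := by
    have h1 : dist xL xM ≤ 2 := by
      rw [Prod.dist_eq, Real.dist_eq, Real.dist_eq]
      exact max_le (abs_le.2 ⟨by linarith [hL.1.1, hM.1.2], by linarith [hL.1.2, hM.1.1]⟩)
        (abs_le.2 ⟨by linarith [hL.2.1, hM.2.2], by linarith [hL.2.2, hM.2.1]⟩)
    rw [← NNReal.coe_le_coe, NNReal.coe_one]
    linarith
  have h2δ : δ ≤ 2 * δ := by
    rw [two_mul]
    exact le_self_add
  have hpath : ∀ l : ℝ≥0 → ℝ × ℝ, IsPathIn SqBall xM fun t =>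
      (evade δ δ xM.1 (fun s => (l s).1) t, evade δ (2 * δ) xM.2 (fun s => (l s).2) t) := by
    refine fun l => ⟨?_, ?_, fun t => ?_⟩
    · simp only [evade_zero]
    · exact lipschitzWith_one_prodMk (lipschitzWith_evade _ hδ le_rfl hM.1)
        (lipschitzWith_evade _ hδ h2δ hM.2)
    · exact ⟨evade_mem_Icc _ t hδ hδ1 le_rfl hM.1, evade_mem_Icc _ t hδ hδ1 h2δ hM.2⟩
  refine ⟨_, ⟨fun l _ => hpath l, fun l l' _ _ t h s hs => ?_⟩, fun l hl t => ?_⟩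
  · exact Prod.ext
      (evade_congr _ hδ fun r hr => congrArg Prod.fst (h r (hr.trans hs)))
      (evade_congr _ hδ fun r hr => congrArg Prod.snd (h r (hr.trans hs)))
  · rcases le_or_gt t δ with ht | ht
    · have ht' : (t : ℝ) ≤ δ := ht
      exact (hl.ne_of_add_lt_dist (hpath l) (by linarith)).symm
    · obtain ⟨k, ⟨h1, h2⟩ | ⟨h1, h2⟩⟩ := exists_mul_lt_le hδ ht
      · exact fun h => evade_ne _ (lipschitzWith_fst_comp hl.2.1) le_rfl k h1 h2
          (congrArg Prod.fst h)
      · exact fun h => evade_ne _ (lipschitzWith_snd_comp hl.2.1) h2δ k h1 h2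
          (congrArg Prod.snd h)

/-- On the closed unit ball of `l_∞²` both players have winning strategies for the lion
and man game, for any distinct starting positions: the lion can guarantee capture by
time 2, and the man can guarantee never to be caught. -/
theorem both_win_on_linfty_square (xL xM : ℝ × ℝ)
    (hL : xL ∈ SqBall) (hM : xM ∈ SqBall) (hne : xL ≠ xM) :
    (∃ Φ, IsLionStrategyIn SqBall xL xM Φ ∧
      ∀ m, IsPathIn SqBall xM m → ∃ t : ℝ≥0, t ≤ 2 ∧ Φ m t = m t) ∧
    (∃ Ψ, IsManStrategyIn SqBall xL xM Ψ ∧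
      ∀ l, IsPathIn SqBall xL l → ∀ t : ℝ≥0, Ψ l t ≠ l t) :=
  ⟨exists_winning_lion_strategy hL, exists_winning_man_strategy hL hM hne⟩

end
end

section
/- There exists a metric space X with starting points p_A, p_B and a target point z such that in the race-to-a-point game on X neither player has even a drawing strategy: for every strategy of player A there is a play consistent with it in which B reaches z strictly before A, and for every strategy of player B there is a play consistent with it in which A reaches z strictly before B. -/
/-!
There is a metric space, with starting points and a target, for which in the race to a
point game neither player has even a drawing strategy.
-/

open NNReal ENNReal

noncomputable section

/-- The first time a path `p` reaches the point `z` (`∞` if it never does). -/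
def reachTime {X : Type*} [MetricSpace X] (z : X) (p : ℝ≥0 → X) : ℝ≥0∞ :=
  ⨅ t ∈ {t : ℝ≥0 | p t = z}, (t : ℝ≥0∞)

/-- A strategy for the player starting at `xSelf`, responding to paths of the opponent
who starts at `xOpp`: a no-lookahead map from opponent paths to own paths. -/
def IsRaceStrategy {X : Type*} [MetricSpace X] (xOpp xSelf : X)
    (Φ : (ℝ≥0 → X) → (ℝ≥0 → X)) : Prop :=
  (∀ b, IsPath xOpp b → IsPath xSelf (Φ b)) ∧
  ∀ b b', IsPath xOpp b → IsPath xOpp b' → ∀ t : ℝ≥0,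
    (∀ s ≤ t, b s = b' s) → ∀ s ≤ t, Φ b s = Φ b' s

/-- Neither player has even a drawing strategy for race to a point on `X` with starting
points `pA`, `pB` and target `z`: against any strategy of player A there is a play in
which B reaches `z` strictly first, and vice versa. -/
def RaceNoDrawingStrategies (X : Type) [MetricSpace X] (pA pB z : X) : Prop :=
  (∀ Φ, IsRaceStrategy pB pA Φ →
    ∃ b, IsPath pB b ∧ reachTime z b < reachTime z (Φ b)) ∧
  (∀ Ψ, IsRaceStrategy pA pB Ψ →
    ∃ a, IsPath pA a ∧ reachTime z a < reachTime z (Ψ a))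

namespace CombRace

/-- The positions at which teeth are attached to the two shafts, which are also the times at
which a player running along a shaft passes them. -/
def root (i : ℕ) : ℝ≥0 := (1 / 2) ^ (i + 1)

lemma root_pos (i : ℕ) : (0 : ℝ) < root i := by
  simp only [root]; positivity

lemma root_succ (i : ℕ) : (root (i + 1) : ℝ) = root i / 2 := by
  simp only [root]; push_cast; ring

lemma root_strictAnti : StrictAnti fun i => (root i : ℝ) :=
  strictAnti_nat_of_succ_lt fun i => by
    have := root_pos i
    rw [root_succ]; linarith

lemma root_le_half (i : ℕ) : (root i : ℝ) ≤ 1 / 2 := by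
  have h := root_strictAnti.antitone (Nat.zero_le i)
  simpa [root] using h

lemma root_le_half_of_lt {i j : ℕ} (h : j < i) : (root i : ℝ) ≤ root j / 2 := by
  rw [← root_succ]; exact root_strictAnti.antitone h

lemma half_root_le_abs_sub {i j : ℕ} (h : i ≠ j) : (root j : ℝ) / 2 ≤ |(root j : ℝ) - root i| := by
  rcases lt_or_gt_of_ne h with h | h
  · have h1 := root_le_half_of_lt h
    have h2 := neg_abs_le ((root j : ℝ) - root i)
    have := root_pos j
    linarith
  · have h1 := root_le_half_of_lt h
    have h2 := le_abs_self ((root j : ℝ) - root i)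
    linarith

/-- The teeth with even index belong to one player, those with odd index to the other. -/
def roots (σ : Bool) : Set ℝ := {y | ∃ i : ℕ, i.bodd = σ ∧ y = root i}

/-- The length of a tooth. -/
def toothLength (i : ℕ) : ℝ := 2 - 7 / 8 * root i

lemma one_le_toothLength (i : ℕ) : 1 ≤ toothLength i := by
  have := root_le_half i
  simp only [toothLength]; linarith

/-- A lower bound for the distance from a point of a shaft to the target. -/
def shaftHeight (σ : Bool) (p : ℝ) : ℝ := 2 - 7 / 8 * p + 1 / 8 * Metric.infDist p (roots σ)

lemma le_shaftHeight (σ : Bool) (p : ℝ) : 2 - 7 / 8 * p ≤ shaftHeight σ p := by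
  have : 0 ≤ Metric.infDist p (roots σ) := Metric.infDist_nonneg
  simp only [shaftHeight]; linarith

lemma shaftHeight_root (i : ℕ) : shaftHeight i.bodd (root i) = toothLength i := by
  have : (root i : ℝ) ∈ roots i.bodd := ⟨i, rfl, rfl⟩
  simp [shaftHeight, toothLength, Metric.infDist_zero_of_mem this]

lemma roots_nonempty (σ : Bool) : (roots σ).Nonempty := by
  cases σ
  · exact ⟨root 0, 0, rfl, rfl⟩
  · exact ⟨root 1, 1, rfl, rfl⟩

lemma lt_shaftHeight_root {σ : Bool} {j : ℕ} (h : j.bodd ≠ σ) :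
    2 - 7 / 8 * (root j : ℝ) < shaftHeight σ (root j) := by
  have : (root j : ℝ) / 2 ≤ Metric.infDist (root j : ℝ) (roots σ) := by
    rw [Metric.le_infDist (roots_nonempty σ)]
    rintro _ ⟨i, rfl, rfl⟩
    exact half_root_le_abs_sub (by rintro rfl; exact h rfl)
  have := root_pos j
  simp only [shaftHeight]; linarith

lemma abs_shaftHeight_sub_le (σ : Bool) (p q : ℝ) :
    |shaftHeight σ p - shaftHeight σ q| ≤ |p - q| := by
  have h1 : Metric.infDist p (roots σ) ≤ Metric.infDist q (roots σ) + |p - q| :=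
    Metric.infDist_le_infDist_add_dist
  have h2 : Metric.infDist q (roots σ) ≤ Metric.infDist p (roots σ) + |q - p| :=
    Metric.infDist_le_infDist_add_dist
  rw [abs_sub_comm q p] at h2
  have h3 := le_abs_self (p - q)
  have h4 := neg_abs_le (p - q)
  simp only [shaftHeight]
  rw [abs_le]
  constructor <;> linarith

/-- The sign of the heights on each of the two sides. -/
def sgn (σ : Bool) : ℝ := if σ then 1 else -1

lemma abs_sgn_mul (σ : Bool) (x : ℝ) : |sgn σ * x| = |x| := by
  cases σ <;> simp [sgn]

/-- The ambient space of the comb, with the supremum metric. -/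
abbrev Ambient : Type := ℝ × BoundedContinuousFunction ℕ ℝ

lemma dist_le_of_coord {u v : Ambient} {r : ℝ} (h1 : |u.1 - v.1| ≤ r)
    (h2 : ∀ k, |u.2 k - v.2 k| ≤ r) : dist u v ≤ r :=
  max_le h1 ((BoundedContinuousFunction.dist_le ((abs_nonneg _).trans h1)).2 h2)

lemma abs_fst_sub_le_dist (u v : Ambient) : |u.1 - v.1| ≤ dist u v :=
  le_max_left (dist u.1 v.1) (dist u.2 v.2)

lemma abs_snd_sub_le_dist (u v : Ambient) (k : ℕ) : |u.2 k - v.2 k| ≤ dist u v :=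
  (BoundedContinuousFunction.dist_coe_le_dist (f := u.2) (g := v.2) k).trans (le_max_right (dist u.1 v.1) _)

/-- The point of the shaft of side `σ` at position `p`. -/
def shaft (σ : Bool) (p : ℝ) : Ambient :=
  (sgn σ * shaftHeight σ p, BoundedContinuousFunction.const ℕ p)

/-- The separating coordinates of the point at depth `x` of the tooth `i`: the `k`-th one is
positive along the tooth `k` and decreases along all others. -/
def toothCoord (i : ℕ) (x : ℝ) (k : ℕ) : ℝ :=
  if k = i then min (root i + x) (toothLength i - x) else max (root i - x) (-(toothLength i - x))

lemma abs_toothCoord_sub_le (i : ℕ) (x y : ℝ) (k : ℕ) :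
    |toothCoord i x k - toothCoord i y k| ≤ |x - y| := by
  simp only [toothCoord]
  split_ifs
  · refine (abs_min_sub_min_le_max _ _ _ _).trans (max_le (le_of_eq ?_) (le_of_eq ?_))
    · congr 1; ring
    · rw [abs_sub_comm x y]; congr 1; ring
  · refine (abs_max_sub_max_le_max _ _ _ _).trans (max_le (le_of_eq ?_) (le_of_eq ?_))
    · rw [abs_sub_comm x y]; congr 1; ring
    · congr 1; ring

lemma toothCoord_zero (i k : ℕ) : toothCoord i 0 k = root i := by
  have h1 := one_le_toothLength i
  have h2 := root_le_half i
  have h3 := root_pos i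
  simp only [toothCoord]
  split_ifs
  · rw [min_eq_left] <;> linarith
  · rw [max_eq_left] <;> linarith

lemma toothCoord_toothLength (i k : ℕ) : toothCoord i (toothLength i) k = 0 := by
  have h1 := one_le_toothLength i
  have h2 := root_le_half i
  have h3 := root_pos i
  simp only [toothCoord]
  split_ifs
  · rw [min_eq_right] <;> linarith
  · rw [max_eq_right] <;> linarith

lemma norm_toothCoord_le (i : ℕ) (x : ℝ) (k : ℕ) : ‖toothCoord i x k‖ ≤ |x| + root i := by
  have h := abs_toothCoord_sub_le i x 0 k
  rw [toothCoord_zero, sub_zero] at h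
  have h2 := abs_sub_abs_le_abs_sub (toothCoord i x k) (root i)
  rw [abs_of_pos (root_pos i)] at h2
  rw [Real.norm_eq_abs]; linarith

/-- The point at depth `x` of the tooth `i`. -/
def tooth (i : ℕ) (x : ℝ) : Ambient :=
  (sgn i.bodd * (toothLength i - x),
    BoundedContinuousFunction.ofNormedAddCommGroupDiscrete (toothCoord i x) (|x| + root i)
      (norm_toothCoord_le i x))

lemma dist_shaft_le (σ : Bool) (p q : ℝ) : dist (shaft σ p) (shaft σ q) ≤ |p - q| := by
  refine dist_le_of_coord ?_ fun k => le_rfl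
  simp only [shaft]
  rw [← mul_sub, abs_sgn_mul]
  exact abs_shaftHeight_sub_le σ p q

lemma dist_tooth_le (i : ℕ) (x y : ℝ) : dist (tooth i x) (tooth i y) ≤ |x - y| := by
  refine dist_le_of_coord ?_ fun k => abs_toothCoord_sub_le i x y k
  simp only [tooth]
  rw [← mul_sub, abs_sgn_mul, abs_sub_comm x y]
  exact le_of_eq (congrArg abs (by ring))

lemma tooth_zero (i : ℕ) : tooth i 0 = shaft i.bodd (root i) := by
  refine Prod.ext ?_ (BoundedContinuousFunction.ext fun k => toothCoord_zero i k)
  simp [tooth, shaft, shaftHeight_root]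

lemma tooth_toothLength (i : ℕ) : tooth i (toothLength i) = 0 := by
  refine Prod.ext ?_ (BoundedContinuousFunction.ext fun k => toothCoord_toothLength i k)
  simp [tooth]

/-- Two combs, one for each player, whose teeth all end in the common point `0`. -/
def comb : Set Ambient :=
  {e | (∃ σ, ∃ p ∈ Set.Icc (0 : ℝ) 1, e = shaft σ p) ∨
    ∃ i, ∃ x ∈ Set.Icc 0 (toothLength i), e = tooth i x}

lemma zero_mem_comb : (0 : Ambient) ∈ comb :=
  Or.inr ⟨0, toothLength 0, ⟨by linarith [one_le_toothLength 0], le_rfl⟩,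
    (tooth_toothLength 0).symm⟩

/-- The common end of all teeth. -/
def target : comb := ⟨0, zero_mem_comb⟩

/-- The starting point on the shaft of side `σ`. -/
def start (σ : Bool) : comb := ⟨shaft σ 0, Or.inl ⟨σ, 0, by simp, rfl⟩⟩

/-- Run along the shaft and rest at its end. -/
def shaftRun (σ : Bool) (t : ℝ≥0) : comb :=
  ⟨shaft σ (min t 1), Or.inl ⟨σ, min t 1, ⟨by positivity, min_le_right _ _⟩, rfl⟩⟩

/-- Run along the shaft up to the root of the tooth `j`, then along this tooth to the target. -/
def toothRun (j : ℕ) (t : ℝ≥0) : comb :=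
  ⟨if t ≤ root j then shaft j.bodd t else tooth j (min (t - root j) (toothLength j)), by
    have hr := root_le_half j
    have hl := one_le_toothLength j
    split_ifs with h
    · have h' : (t : ℝ) ≤ root j := h
      exact Or.inl ⟨_, t, ⟨t.2, by linarith⟩, rfl⟩
    · have h' : (root j : ℝ) < t := lt_of_not_ge h
      exact Or.inr ⟨j, _, ⟨le_min (by linarith) (by linarith), min_le_right _ _⟩, rfl⟩⟩

lemma lipschitzWith_one_of_le {X : Type*} [PseudoMetricSpace X] {f : ℝ≥0 → X}
    (h : ∀ s t : ℝ≥0, s ≤ t → dist (f s) (f t) ≤ (t : ℝ) - s) : LipschitzWith 1 f := by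
  refine LipschitzWith.of_dist_le_mul fun s t => ?_
  rw [NNReal.coe_one, one_mul, NNReal.dist_eq]
  rcases le_total s t with hst | hst
  · exact (h s t hst).trans ((le_abs_self _).trans (abs_sub_comm _ _).le)
  · rw [dist_comm]
    exact (h t s hst).trans (le_abs_self _)

lemma isPath_shaftRun (σ : Bool) : IsPath (start σ) (shaftRun σ) := by
  refine ⟨Subtype.ext (by simp [shaftRun, start]), lipschitzWith_one_of_le fun s t hst => ?_⟩
  have hst' : (s : ℝ) ≤ t := hst
  refine (dist_shaft_le σ _ _).trans ((abs_min_sub_min_le_max _ _ _ _).trans ?_)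
  simp only [sub_self, abs_zero]
  refine max_le ?_ (by linarith)
  rw [abs_sub_comm, abs_of_nonneg (by linarith)]

lemma isPath_toothRun (j : ℕ) : IsPath (start j.bodd) (toothRun j) := by
  refine ⟨Subtype.ext (by simp [toothRun, start]), lipschitzWith_one_of_le fun s t hst => ?_⟩
  have hst' : (s : ℝ) ≤ t := hst
  have on_tooth : ∀ u v : ℝ, u ≤ v → dist (tooth j (min u (toothLength j)))
      (tooth j (min v (toothLength j))) ≤ v - u := by
    intro u v huv
    refine (dist_tooth_le j _ _).trans ((abs_min_sub_min_le_max _ _ _ _).trans ?_)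
    simp only [sub_self, abs_zero]
    refine max_le ?_ (by linarith)
    rw [abs_sub_comm, abs_of_nonneg (by linarith)]
  simp only [Subtype.dist_eq, toothRun]
  split_ifs with h1 h2 h2
  · refine (dist_shaft_le _ _ _).trans ?_
    rw [abs_sub_comm, abs_of_nonneg (by linarith)]
  · have h1' : (s : ℝ) ≤ root j := h1
    have h2' : (root j : ℝ) < t := lt_of_not_ge h2
    refine (dist_triangle _ (tooth j 0) _).trans ?_
    have h3 := dist_shaft_le j.bodd s (root j)
    rw [← tooth_zero, abs_sub_comm, abs_of_nonneg (by linarith)] at h3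
    have h4 := on_tooth 0 (t - root j) (by linarith)
    rw [min_eq_left (by linarith [one_le_toothLength j])] at h4
    linarith
  · exact absurd (hst.trans h2) h1
  · exact (on_tooth _ _ (by linarith)).trans (by linarith)

lemma toothRun_eq_shaftRun {j : ℕ} {t : ℝ≥0} (h : t ≤ root j) :
    shaftRun j.bodd t = toothRun j t := by
  have h' : (t : ℝ) ≤ root j := h
  have hr := root_le_half j
  refine Subtype.ext ?_
  simp only [shaftRun, toothRun, if_pos h]
  rw [min_eq_left (by linarith)]

lemma reachTime_toothRun_le (j : ℕ) :
    reachTime target (toothRun j) ≤ ENNReal.ofReal (2 + 1 / 8 * root j) := by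
  have hr := root_pos j
  refine iInf₂_le (Real.toNNReal (2 + 1 / 8 * root j)) ?_
  have h0 : ((Real.toNNReal (2 + 1 / 8 * root j) : ℝ≥0) : ℝ) = 2 + 1 / 8 * root j :=
    Real.coe_toNNReal _ (by linarith)
  have h1 : ¬ Real.toNNReal (2 + 1 / 8 * root j) ≤ root j := by
    rw [← NNReal.coe_le_coe, h0]
    linarith [root_le_half j]
  refine Subtype.ext ?_
  simp only [toothRun, if_neg h1, h0]
  rw [min_eq_right (by simp only [toothLength]; linarith)]
  exact tooth_toothLength j

lemma abs_fst_sub_le_of_isPath {x : comb} {a : ℝ≥0 → comb} (ha : IsPath x a) (s t : ℝ≥0) :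
    |(a s).1.1 - (a t).1.1| ≤ |(s : ℝ) - t| := by
  have h := ha.2.dist_le_mul s t
  rw [NNReal.coe_one, one_mul, NNReal.dist_eq] at h
  exact (abs_fst_sub_le_dist _ _).trans h

lemma abs_snd_sub_le_of_isPath {x : comb} {a : ℝ≥0 → comb} (ha : IsPath x a) (s t : ℝ≥0)
    (k : ℕ) : |(a s).1.2 k - (a t).1.2 k| ≤ |(s : ℝ) - t| := by
  have h := ha.2.dist_le_mul s t
  rw [NNReal.coe_one, one_mul, NNReal.dist_eq] at h
  exact (abs_snd_sub_le_dist _ _ k).trans h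

lemma le_sgn_mul_fst {σ : Bool} {a : ℝ≥0 → comb} (ha : IsPath (start σ) a) (t : ℝ≥0) :
    2 - t ≤ sgn σ * (a t).1.1 := by
  have h := abs_fst_sub_le_of_isPath ha 0 t
  have h2 := le_shaftHeight σ 0
  have h3 : (a 0).1.1 = sgn σ * shaftHeight σ 0 := by rw [ha.1]; rfl
  rw [h3, NNReal.coe_zero, zero_sub, abs_neg, abs_of_nonneg t.coe_nonneg, abs_le] at h
  cases σ <;> simp only [sgn] at h ⊢ <;> norm_num at h ⊢ <;> linarith

lemma abs_fst_add_le_reachTime {σ : Bool} {a : ℝ≥0 → comb} (ha : IsPath (start σ) a)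
    {t : ℝ≥0} (ht : t < 2) :
    ENNReal.ofReal (|(a t).1.1| + t) ≤ reachTime target a := by
  refine le_iInf₂ fun u hu => ?_
  have hu' : a u = target := hu
  have hz : (a u).1.1 = 0 := by rw [hu']; rfl
  have h2 : (2 : ℝ) - u ≤ 0 := by simpa [hz] using le_sgn_mul_fst ha u
  have ht' : (t : ℝ) < 2 := ht
  have h := abs_fst_sub_le_of_isPath ha t u
  rw [hz, sub_zero, abs_sub_comm (t : ℝ), abs_of_nonneg (a := (u : ℝ) - t) (by linarith)] at h
  rw [ENNReal.ofReal_le_iff_le_toReal ENNReal.coe_ne_top, ENNReal.coe_toReal]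
  linarith

/-- A player who at time `root j` is as close to the target as the opponent leaving through the
tooth `j` has already entered an earlier tooth, almost without detour. -/
lemma exists_tooth_of_abs_fst_le {σ : Bool} {a : ℝ≥0 → comb} (ha : IsPath (start σ) a) {j : ℕ}
    (hj : j.bodd ≠ σ) (hH : |(a (root j)).1.1| ≤ 2 - 7 / 8 * root j) :
    ∃ i x, j < i ∧ (a (root j)).1 = tooth i x ∧ 1 ≤ toothLength i - x ∧ root i + x ≤ root j ∧
      7 / 8 * ((root j : ℝ) - root i) ≤ x := by
  have hs := le_sgn_mul_fst ha (root j)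
  have hc := abs_snd_sub_le_of_isPath ha (root j) 0
  have hr := root_le_half j
  have hc0 : ∀ k, (a 0).1.2 k = 0 := fun k => by rw [ha.1]; rfl
  simp only [hc0, NNReal.coe_zero, sub_zero, abs_of_pos (root_pos j)] at hc
  have sgn_eq : ∀ {ρ : Bool} {h : ℝ}, 0 ≤ h → 2 - root j ≤ sgn σ * (sgn ρ * h) → ρ = σ := by
    intro ρ h h0 h1
    cases ρ <;> cases σ <;> simp only [sgn] at h1 <;> norm_num at h1 ⊢ <;> linarith
  have sgn_sq : ∀ h : ℝ, sgn σ * (sgn σ * h) = h := fun h => by cases σ <;> simp [sgn]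
  rcases (a (root j)).2 with ⟨ρ, p, hp, he⟩ | ⟨i, x, hx, he⟩
  · rw [he] at hs hH
    simp only [he] at hc
    have hle := le_shaftHeight ρ p
    obtain rfl := sgn_eq (by linarith [hp.2]) hs
    have hpj : p ≤ root j := (le_abs_self p).trans (hc 0)
    simp only [shaft, abs_sgn_mul] at hH
    have hH' := (le_abs_self _).trans hH
    rcases hpj.lt_or_eq with h | rfl
    · linarith
    · linarith [lt_shaftHeight_root hj]
  · rw [he] at hs hH
    simp only [he] at hc
    obtain rfl := sgn_eq (sub_nonneg.2 hx.2) hs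
    simp only [tooth] at hs
    rw [sgn_sq] at hs
    simp only [tooth, abs_sgn_mul] at hH
    have hH' := (le_abs_self _).trans hH
    have hci : min ((root i : ℝ) + x) (toothLength i - x) ≤ root j := by
      have h := (le_abs_self _).trans (hc i)
      simpa [tooth, toothCoord] using h
    have hix : (root i : ℝ) + x ≤ root j := by
      rcases min_le_iff.1 hci with h | h
      · exact h
      · linarith
    have hij : j < i := by
      refine lt_of_le_of_ne ?_ (by rintro rfl; exact hj rfl)
      exact root_strictAnti.le_iff_ge.1 (by linarith [hx.1])
    refine ⟨i, x, hij, he, by linarith, hix, ?_⟩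
    simp only [toothLength] at hH'
    linarith

/-- No path keeps up with the opponent leaving through any of the opponent's teeth. -/
lemma exists_lt_abs_fst {σ τ : Bool} (hστ : τ ≠ σ) {a : ℝ≥0 → comb} (ha : IsPath (start σ) a) :
    ∃ j : ℕ, j.bodd = τ ∧ 2 - 7 / 8 * (root j : ℝ) < |(a (root j)).1.1| := by
  by_contra! hcon
  obtain ⟨j₀, hj₀⟩ : ∃ j : ℕ, j.bodd = τ := by
    cases τ
    · exact ⟨0, rfl⟩
    · exact ⟨1, rfl⟩
  have hpar : ∀ n, (j₀ + 2 * n).bodd = τ := fun n => by simp [hj₀]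
  choose i x hlt he hL hle hx using fun n =>
    exists_tooth_of_abs_fst_le ha (by rw [hpar n]; exact hστ) (hcon _ (hpar n))
  have hstep : ∀ n, i (n + 1) = i n := by
    intro n
    by_contra hne
    have hc := (le_abs_self _).trans (abs_snd_sub_le_of_isPath ha (root (j₀ + 2 * n))
      (root (j₀ + 2 * (n + 1))) (i n))
    rw [he n, he (n + 1)] at hc
    have hr : (root (j₀ + 2 * (n + 1)) : ℝ) = root (j₀ + 2 * n) / 4 := by
      rw [show j₀ + 2 * (n + 1) = j₀ + 2 * n + 1 + 1 by ring, root_succ, root_succ]; ring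
    have h1 : (tooth (i n) (x n)).2 (i n) =
        min (root (i n) + x n) (toothLength (i n) - x n) := by
      simp [tooth, toothCoord]
    have h2 : (tooth (i (n + 1)) (x (n + 1))).2 (i n) =
        max (root (i (n + 1)) - x (n + 1)) (-(toothLength (i (n + 1)) - x (n + 1))) := by
      simp [tooth, toothCoord, Ne.symm hne]
    have p0 := root_pos (j₀ + 2 * n)
    have p1 := root_pos (i n)
    have p2 := root_pos (i (n + 1))
    have q := root_le_half (j₀ + 2 * n)
    have l0 := hle n
    have l1 := hle (n + 1)
    have x0 := hx n
    have x1 := hx (n + 1)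
    have L0 := hL n
    have L1 := hL (n + 1)
    have hhalf := root_le_half_of_lt (hlt (n + 1))
    rw [hr] at hc l1 x1 hhalf
    rw [h1, h2, min_eq_left (by linarith), max_eq_left (by linarith),
      abs_of_pos (by linarith)] at hc
    linarith
  have hconst : ∀ n, i n = i 0 := fun n => by
    induction n with
    | zero => rfl
    | succ n ih => rw [hstep, ih]
  have := hlt (i 0)
  rw [hconst (i 0)] at this
  omega

lemma exists_reachTime_lt {σ τ : Bool} (hστ : τ ≠ σ) {Φ : (ℝ≥0 → comb) → ℝ≥0 → comb}
    (hΦ : IsRaceStrategy (start τ) (start σ) Φ) :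
    ∃ b, IsPath (start τ) b ∧ reachTime target b < reachTime target (Φ b) := by
  obtain ⟨j, rfl, hj⟩ := exists_lt_abs_fst hστ (hΦ.1 _ (isPath_shaftRun τ))
  refine ⟨toothRun j, isPath_toothRun j, (reachTime_toothRun_le j).trans_lt ?_⟩
  have hr : (root j : ℝ) < 2 := by linarith [root_le_half j]
  refine lt_of_lt_of_le ?_
    (abs_fst_add_le_reachTime (hΦ.1 _ (isPath_toothRun j)) (t := root j) hr)
  rw [hΦ.2 _ _ (isPath_shaftRun _) (isPath_toothRun j) (root j)
    (fun s hs => toothRun_eq_shaftRun hs) _ le_rfl] at hj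
  have := root_pos j
  rw [ENNReal.ofReal_lt_ofReal_iff (by positivity)]
  linarith

end CombRace

/-- There are a metric space `X`, starting points `pA`, `pB` and a target `z` such that
in the race-to-a-point game on `X` neither player has even a drawing strategy: for
every strategy of player A there is a consistent play in which B reaches `z` strictly
before A, and for every strategy of player B there is a consistent play in which A
reaches `z` strictly before B. -/
theorem race_to_point_neither_draws :
    ∃ (X : Type) (i : MetricSpace X) (pA pB z : X),
      @RaceNoDrawingStrategies X i pA pB z := by
  exact ⟨CombRace.comb, inferInstance, CombRace.start true, CombRace.start false,
    CombRace.target, fun _ hΦ => CombRace.exists_reachTime_lt (by simp) hΦ,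
    fun _ hΨ => CombRace.exists_reachTime_lt (by simp) hΨ⟩

end
end

section
/- There exist sets A, B ⊆ (0,1) such that for no t₀ > 0 is there a continuous function f : [0,t₀] → [0,t₀] with f(0) = 0 and f(t) ∈ A for every t ∈ B ∩ [0,t₀], and likewise for no t₀ > 0 is there a continuous function f : [0,t₀] → [0,t₀] with f(0) = 0 and f(t) ∈ B for every t ∈ A ∩ [0,t₀]. -/
/-!
There are sets A, B ⊆ (0,1) such that for no t₀ > 0 is there a continuous function
f : [0,t₀] → [0,t₀] with f(0) = 0 mapping B into A, nor one mapping A into B.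
-/

open Set

open Cardinal in
/-- If there are at most as many pairs `(f j, D j)` as elements in each infinite set `D j`, and
`f j` is injective on `D j`, then points `x j ∈ D j` can be picked so that `f i` maps no `x i` to
some `x j` with `j ≠ i`. -/
theorem exists_forall_mem_image_ne {J X : Type} (f : J → X → X) (D : J → Set X)
    (hinj : ∀ j, InjOn (f j) (D j)) (hinf : ∀ j, ℵ₀ ≤ #(D j)) (hJ : ∀ j, #J ≤ #(D j)) :
    ∃ x : J → X, (∀ j, x j ∈ D j) ∧ ∀ i j, i ≠ j → f i (x i) ≠ x j := by
  obtain ⟨_, _, hr⟩ := exists_ord_eq_type_lt J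
  have step : ∀ j (y : ∀ i, i < j → X), ∃ t ∈ D j,
      (∀ i h, f i (y i h) ≠ t) ∧ ∀ i h, f j t ≠ y i h := by
    intro j y
    have hlt : #(Iio j) < #(D j) := (mk_Iio_lt j hr).trans_le (hJ j)
    let S : Set X := range fun i : Iio j => f i.1 (y i.1 i.2)
    let T : Set X := {t ∈ D j | f j t ∈ range fun i : Iio j => y i.1 i.2}
    have hS : #S ≤ #(Iio j) := mk_range_le
    have hT : #T ≤ #(Iio j) := by
      rw [← mk_image_eq_of_injOn (f j) T ((hinj j).mono (sep_subset _ _))]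
      have hsub : f j '' T ⊆ range fun i : Iio j => y i.1 i.2 := image_subset_iff.2 fun _ ht => ht.2
      exact (mk_le_mk_of_subset hsub).trans mk_range_le
    have hST : #(S ∪ T : Set X) < #(D j) :=
      (mk_union_le S T).trans_lt (add_lt_of_lt (hinf j) (hS.trans_lt hlt) (hT.trans_lt hlt))
    obtain ⟨t, htD, htST⟩ : ∃ t ∈ D j, t ∉ S ∪ T := by
      by_contra! h
      exact hST.not_ge (mk_le_mk_of_subset h)
    refine ⟨t, htD, fun i h e => htST (.inl ⟨⟨i, h⟩, e⟩), fun i h e => htST (.inr ⟨htD, ?_⟩)⟩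
    exact ⟨⟨i, h⟩, e.symm⟩
  choose g hgD hg₁ hg₂ using step
  let x : J → X := wellFounded_lt.fix g
  have hx : ∀ j, x j = g j fun i _ => x i := wellFounded_lt.fix_eq g
  refine ⟨x, fun j => hx j ▸ hgD j _, fun i j hij => ?_⟩
  rcases lt_trichotomy i j with h | h | h
  · rw [hx j]
    exact hg₁ j (fun i _ => x i) i h
  · exact absurd h hij
  · rw [hx i]
    exact hg₂ i (fun k _ => x k) j h

open Cardinal in
theorem mk_continuousMap_real_le : #C(ℝ, ℝ) ≤ 𝔠 := by
  have hinj : Function.Injective fun (g : C(ℝ, ℝ)) (q : ℚ) => g q := fun g h e =>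
    ContinuousMap.ext fun x => congrFun
      (Rat.isDenseEmbedding_coe_real.dense.equalizer g.continuous h.continuous e) x
  simpa [mk_real] using mk_le_of_injective hinj

open Cardinal in
/-- A continuous function which vanishes at `0` but not at `t > 0` is injective on a subset of
`(0, t)` of cardinality continuum. -/
theorem exists_injOn_mk_eq_continuum {f : ℝ → ℝ} {t : ℝ} (ht : 0 < t)
    (hf : ContinuousOn f (Icc 0 t)) (h0 : f 0 = 0) (hft : f t ≠ 0) :
    ∃ D ⊆ Ioo 0 t, InjOn f D ∧ #D = 𝔠 := by
  obtain ⟨a, b, hab, hsub⟩ : ∃ a b : ℝ, a < b ∧ Ioo a b ⊆ f '' Ioo 0 t := by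
    rcases hft.lt_or_gt with h | h
    · exact ⟨f t, f 0, h0.symm ▸ h, intermediate_value_Ioo' ht.le hf⟩
    · exact ⟨f 0, f t, h0.symm ▸ h, intermediate_value_Ioo ht.le hf⟩
  obtain ⟨D, hD, hbij⟩ := SurjOn.exists_bijOn_subset hsub
  refine ⟨D, hD, hbij.injOn, ?_⟩
  rw [← mk_image_eq_of_injOn f D hbij.injOn, hbij.image_eq, mk_Ioo_real hab]

open Cardinal in
/-- There are `A, B ⊆ (0,1)` such that a continuous function vanishing at `0` but not on all
of `(0,t₀] ∩ (0,1)` maps neither `B ∩ [0,t₀]` into `A` nor `A ∩ [0,t₀]` into `B`. -/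
theorem exists_sets_forall_continuousOn_exists_notMem :
    ∃ S : Bool → Set ℝ, (∀ c, S c ⊆ Ioo (0 : ℝ) 1) ∧
      ∀ (c : Bool) (t₀ : ℝ) (f : ℝ → ℝ), ContinuousOn f (Icc 0 t₀) → f 0 = 0 →
        (∃ t ∈ Ioo (0 : ℝ) 1, t ≤ t₀ ∧ f t ≠ 0) → ∃ t ∈ S c ∩ Icc 0 t₀, f t ∉ S !c := by
  let J := {p : (C(ℝ, ℝ) × ℝ) × Bool //
    ∃ D ⊆ Ioo (0 : ℝ) 1 ∩ Icc 0 p.1.2, InjOn p.1.1 D ∧ #D = 𝔠}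
  have hJ : #J ≤ 𝔠 := by
    refine (mk_subtype_le _).trans ?_
    simp only [mk_prod, lift_id, mk_real, mk_bool]
    exact mul_le_of_le aleph0_le_continuum
      (mul_le_of_le aleph0_le_continuum mk_continuousMap_real_le le_rfl)
      (ofNat_lt_aleph0.le.trans aleph0_le_continuum)
  choose D hDsub hDinj hDcard using fun j : J => j.2
  obtain ⟨x, hxD, hx⟩ := exists_forall_mem_image_ne (fun j : J => (j.1.1.1 : ℝ → ℝ)) D hDinj
    (fun j => (hDcard j).symm ▸ aleph0_le_continuum) (fun j => (hDcard j).symm ▸ hJ)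
  refine ⟨fun c => {y | ∃ j : J, j.1.2 = c ∧ x j = y}, ?_, ?_⟩
  · rintro c _ ⟨j, -, rfl⟩
    exact (hDsub j (hxD j)).1
  · rintro c t₀ f hf h0 ⟨t, ht, htt₀, hft⟩
    have ht₀ : 0 ≤ t₀ := ht.1.le.trans htt₀
    let g : C(ℝ, ℝ) := ⟨IccExtend ht₀ (domRestrict (Icc 0 t₀) f), hf.domRestrict.Icc_extend'⟩
    have hg : ∀ s ∈ Icc 0 t₀, g s = f s := fun s hs => IccExtend_of_mem ht₀ (domRestrict (Icc 0 t₀) f) hs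
    obtain ⟨E, hE, hEinj, hEcard⟩ := exists_injOn_mk_eq_continuum (f := g) ht.1
      g.continuous.continuousOn (by rw [hg 0 ⟨le_rfl, ht₀⟩, h0])
      (by rwa [hg t ⟨ht.1.le, htt₀⟩])
    let j : J := ⟨((g, t₀), c), E, fun s hs => ⟨⟨(hE hs).1, (hE hs).2.trans ht.2⟩,
      (hE hs).1.le, (hE hs).2.le.trans htt₀⟩, hEinj, hEcard⟩
    have hj : x j ∈ Icc 0 t₀ := (hDsub j (hxD j)).2
    refine ⟨x j, ⟨⟨j, rfl, rfl⟩, hj⟩, ?_⟩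
    rintro ⟨k, hk, hkx⟩
    refine hx j k (fun e => ?_) ((hg _ hj).trans hkx.symm)
    rw [← e] at hk
    exact Bool.not_ne_self c hk.symm

/-- There are sets `A, B ⊆ (0,1)` such that for no `t₀ > 0` is there a continuous
`f : [0,t₀] → [0,t₀]` with `f 0 = 0` and `f(B ∩ [0,t₀]) ⊆ A`, and likewise none with
`f(A ∩ [0,t₀]) ⊆ B`. -/
theorem exists_incomparable_sets :
    ∃ A B : Set ℝ, A ⊆ Ioo (0 : ℝ) 1 ∧ B ⊆ Ioo (0 : ℝ) 1 ∧
      (∀ t₀ : ℝ, 0 < t₀ →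
        ¬ ∃ f : ℝ → ℝ, ContinuousOn f (Icc 0 t₀) ∧ MapsTo f (Icc 0 t₀) (Icc 0 t₀) ∧
          f 0 = 0 ∧ ∀ t ∈ B ∩ Icc 0 t₀, f t ∈ A) ∧
      (∀ t₀ : ℝ, 0 < t₀ →
        ¬ ∃ f : ℝ → ℝ, ContinuousOn f (Icc 0 t₀) ∧ MapsTo f (Icc 0 t₀) (Icc 0 t₀) ∧
          f 0 = 0 ∧ ∀ t ∈ A ∩ Icc 0 t₀, f t ∈ B) := by
  obtain ⟨S, hS, hSf⟩ := exists_sets_forall_continuousOn_exists_notMem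
  have key : ∀ (c : Bool) (t₀ : ℝ), 0 < t₀ → ¬ ∃ f : ℝ → ℝ, ContinuousOn f (Icc 0 t₀) ∧
      MapsTo f (Icc 0 t₀) (Icc 0 t₀) ∧ f 0 = 0 ∧ ∀ t ∈ S c ∩ Icc 0 t₀, f t ∈ S !c := by
    rintro c t₀ ht₀ ⟨f, hf, -, h0, hmem⟩
    by_cases h : ∃ t ∈ Ioo (0 : ℝ) 1, t ≤ t₀ ∧ f t ≠ 0
    · obtain ⟨t, ht, hft⟩ := hSf c t₀ f hf h0 h
      exact hft (hmem t ht)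
    · push Not at h
      have hpos : 0 < min t₀ (1 / 2) := by positivity
      obtain ⟨t, ht, -⟩ := hSf c t₀ id continuousOn_id rfl ⟨min t₀ (1 / 2),
        ⟨hpos, (min_le_right _ _).trans_lt (by norm_num)⟩, min_le_left _ _, hpos.ne'⟩
      have hft := hS _ (hmem t ht)
      rw [h t (hS c ht.1) ht.2.2] at hft
      exact lt_irrefl _ hft.1
  exact ⟨S false, S true, hS _, hS _, key true, key false⟩
end

section
/- Let X be a complete metric space with fixed starting points, let Ψ be a locally finite man strategy, and let Φ be any lion strategy. Then there exist paths l ∈ L and m ∈ M with Φ(m) = l and Ψ(l) = m, and moreover this pair (l, m) is unique. -/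
/-!
Proposition (Appendix): in a complete metric space, a locally finite man strategy Ψ and
an arbitrary lion strategy Φ have a unique common play: paths l, m with Φ m = l and
Ψ l = m.
-/

open NNReal

noncomputable section

/-- A man strategy is locally finite if whenever two lion paths agree on `[0,t]`, the
corresponding man paths agree on `[0,t+ε]` for some `ε > 0` depending only on the lion
path restricted to `[0,t]`. -/
def IsLocallyFiniteManStrategy {X : Type*} [MetricSpace X] (xL : X)
    (Ψ : (ℝ≥0 → X) → (ℝ≥0 → X)) : Prop :=
  ∀ l, IsPath xL l → ∀ t : ℝ≥0, ∃ ε : ℝ≥0, 0 < ε ∧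
    ∀ l', IsPath xL l' → (∀ s ≤ t, l s = l' s) →
      ∀ s ≤ t + ε, Ψ l s = Ψ l' s

/-- `l` is a path from `x` that is a fixed point of `F` up to time `t`. -/
def IsFixedUpTo {X : Type*} [MetricSpace X] (x : X) (F : (ℝ≥0 → X) → (ℝ≥0 → X))
    (l : ℝ≥0 → X) (t : ℝ≥0) : Prop :=
  IsPath x l ∧ ∀ s ≤ t, F l s = l s

/-- `F` maps paths to paths, and the restriction of a path to `[0,t]` determines its image
on some longer interval `[0,t+ε]`. -/
def IsStrictlyCausal {X : Type*} [MetricSpace X] (x : X)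
    (F : (ℝ≥0 → X) → (ℝ≥0 → X)) : Prop :=
  (∀ l, IsPath x l → IsPath x (F l)) ∧
  ∀ l, IsPath x l → ∀ t : ℝ≥0, ∃ ε : ℝ≥0, 0 < ε ∧
    ∀ l', IsPath x l' → (∀ s ≤ t, l s = l' s) → ∀ s ≤ t + ε, F l s = F l' s

section

variable {X : Type*} [MetricSpace X] {x : X} {F : (ℝ≥0 → X) → (ℝ≥0 → X)}

theorem IsPath.eq_of_eq_of_lt {f g : ℝ≥0 → X} (hf : IsPath x f) (hg : IsPath x g)
    {c : ℝ≥0} (h : ∀ s < c, f s = g s) : ∀ s ≤ c, f s = g s := by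
  rcases eq_or_ne c 0 with rfl | hc
  · intro s hs
    rw [nonpos_iff_eq_zero.mp hs, hf.1, hg.1]
  · have hne : (Set.Iio c).Nonempty := ⟨0, pos_iff_ne_zero.mpr hc⟩
    have h' : Set.EqOn f g (closure (Set.Iio c)) :=
      Set.EqOn.closure (fun s hs => h s hs) hf.2.continuous hg.2.continuous
    rw [closure_Iio' hne] at h'
    exact fun s hs => h' hs

theorem IsStrictlyCausal.eq_of_isFixedUpTo (hF : IsStrictlyCausal x F)
    {l l' : ℝ≥0 → X} {t : ℝ≥0} (hl : IsFixedUpTo x F l t) (hl' : IsFixedUpTo x F l' t) :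
    ∀ s ≤ t, l s = l' s := by
  set S : Set ℝ≥0 := {s | s ≤ t ∧ ∀ r ≤ s, l r = l' r}
  have hbdd : BddAbove S := ⟨t, fun s hs => hs.1⟩
  have h0 : (0 : ℝ≥0) ∈ S := by
    refine ⟨zero_le, fun r hr => ?_⟩
    rw [nonpos_iff_eq_zero.mp hr, hl.1.1, hl'.1.1]
  have hc : ∀ s ≤ sSup S, l s = l' s := by
    refine hl.1.eq_of_eq_of_lt hl'.1 fun s hs => ?_
    obtain ⟨r, hr, hsr⟩ := exists_lt_of_lt_csSup ⟨0, h0⟩ hs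
    exact hr.2 s hsr.le
  obtain ⟨ε, hε, h⟩ := hF.2 l hl.1 (sSup S)
  have hmem : min (sSup S + ε) t ∈ S := by
    refine ⟨min_le_right _ _, fun r hr => ?_⟩
    have hrt := hr.trans (min_le_right _ _)
    rw [← hl.2 r hrt, ← hl'.2 r hrt]
    exact h l' hl'.1 hc r (hr.trans (min_le_left _ _))
  have hle := le_csSup hbdd hmem
  have ht : t ≤ sSup S := by
    rcases min_le_iff.mp hle with h1 | h1
    · exact absurd h1 (not_le.mpr (lt_add_of_pos_right _ hε))
    · exact h1
  exact fun s hs => hc s (hs.trans ht)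

theorem IsFixedUpTo.mono {l : ℝ≥0 → X} {s t : ℝ≥0} (hl : IsFixedUpTo x F l t)
    (hst : s ≤ t) : IsFixedUpTo x F l s :=
  ⟨hl.1, fun r hr => hl.2 r (hr.trans hst)⟩

theorem IsStrictlyCausal.isFixedUpTo_of_eq (hF : IsStrictlyCausal x F)
    {l l' : ℝ≥0 → X} {t : ℝ≥0} (hl : IsFixedUpTo x F l t) (hl' : IsPath x l')
    (h : ∀ s ≤ t, l s = l' s) : IsFixedUpTo x F l' t := by
  obtain ⟨ε, -, hε⟩ := hF.2 l hl.1 t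
  refine ⟨hl', fun s hs => ?_⟩
  rw [← hε l' hl' h s (hs.trans le_self_add), hl.2 s hs, h s hs]

theorem IsStrictlyCausal.exists_isFixedUpTo_add (hF : IsStrictlyCausal x F)
    {l : ℝ≥0 → X} {t : ℝ≥0} (hl : IsFixedUpTo x F l t) :
    ∃ ε : ℝ≥0, 0 < ε ∧ IsFixedUpTo x F (F l) (t + ε) := by
  obtain ⟨ε, hε, h⟩ := hF.2 l hl.1 t
  exact ⟨ε, hε, hF.1 l hl.1, fun s hs =>
    (h (F l) (hF.1 l hl.1) (fun r hr => (hl.2 r hr).symm) s hs).symm⟩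

/-- Partial fixed points on a set of times glue together. -/
theorem IsStrictlyCausal.exists_glue (hF : IsStrictlyCausal x F) {G : Set ℝ≥0}
    (hG : ∀ t ∈ G, ∃ l, IsFixedUpTo x F l t) :
    ∃ g : ℝ≥0 → X, LipschitzOnWith 1 g G ∧
      ∀ t ∈ G, ∀ l, IsFixedUpTo x F l t → ∀ s ∈ G, s ≤ t → l s = g s := by
  have hG' : ∀ t, ∃ l : ℝ≥0 → X, t ∈ G → IsFixedUpTo x F l t := fun t => by
    by_cases ht : t ∈ G
    · obtain ⟨l, hl⟩ := hG t ht
      exact ⟨l, fun _ => hl⟩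
    · exact ⟨fun _ => x, fun h => absurd h ht⟩
  choose L hL using hG'
  have key : ∀ t ∈ G, ∀ l, IsFixedUpTo x F l t → ∀ s ∈ G, s ≤ t → l s = L s s :=
    fun t _ l hl s hs hst => hF.eq_of_isFixedUpTo (hl.mono hst) (hL s hs) s le_rfl
  refine ⟨fun t => L t t, LipschitzOnWith.of_dist_le_mul fun s hs t ht => ?_, key⟩
  rcases le_total s t with hst | hst
  · rw [← key t ht (L t) (hL t ht) s hs hst]
    exact (hL t ht).1.2.dist_le_mul s t
  · rw [← key s hs (L s) (hL s hs) t ht hst]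
    exact (hL s hs).1.2.dist_le_mul s t

theorem LipschitzOnWith.exists_lipschitzWith_eqOn_Iio [CompleteSpace X] {g : ℝ≥0 → X}
    {T : ℝ≥0} (hT : 0 < T) (hg : LipschitzOnWith 1 g (Set.Iio T)) :
    ∃ l : ℝ≥0 → X, LipschitzWith 1 l ∧ ∀ s < T, l s = g s := by
  obtain ⟨u, -, hu, hlim⟩ := exists_seq_strictMono_tendsto' hT
  have huT : ∀ n, u n ∈ Set.Iio T := fun n => (hu n).2
  have hcauchy : CauchySeq (fun n => g (u n)) := by
    rw [Metric.cauchySeq_iff]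
    intro ε hε
    obtain ⟨N, hN⟩ := Metric.cauchySeq_iff.mp hlim.cauchySeq ε hε
    refine ⟨N, fun m hm n hn => lt_of_le_of_lt ?_ (hN m hm n hn)⟩
    simpa using hg.dist_le_mul _ (huT m) _ (huT n)
  obtain ⟨p, hp⟩ := cauchySeq_tendsto_of_complete hcauchy
  have hdist : ∀ s < T, dist (g s) p ≤ dist s T := fun s hs =>
    le_of_tendsto_of_tendsto' (tendsto_const_nhds.dist hp) (tendsto_const_nhds.dist hlim)
      fun n => by simpa using hg.dist_le_mul _ hs _ (huT n)
  have hdist' : ∀ s < T, ∀ t, T ≤ t → dist (g s) p ≤ dist s t := fun s hs t ht => by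
    refine (hdist s hs).trans ?_
    have h1 : (s : ℝ) < T := hs
    have h2 : (T : ℝ) ≤ t := ht
    rw [NNReal.dist_eq, NNReal.dist_eq, abs_of_neg (by linarith), abs_of_neg (by linarith)]
    linarith
  refine ⟨fun s => if s < T then g s else p, LipschitzWith.of_dist_le_mul fun s t => ?_,
    fun s hs => if_pos hs⟩
  rw [NNReal.coe_one, one_mul]
  rcases lt_or_ge s T with hs | hs <;> rcases lt_or_ge t T with ht | ht
  · simpa [hs, ht] using hg.dist_le_mul _ hs _ ht
  · simpa [hs, ht.not_gt] using hdist' s hs t ht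
  · simpa [hs.not_gt, ht, dist_comm] using hdist' t ht s hs
  · simp [hs.not_gt, ht.not_gt]

theorem IsStrictlyCausal.exists_isFixedUpTo_of_lt [CompleteSpace X]
    (hF : IsStrictlyCausal x F) {T : ℝ≥0} (h : ∀ t < T, ∃ l, IsFixedUpTo x F l t) :
    ∃ l, IsFixedUpTo x F l T := by
  rcases eq_or_ne T 0 with rfl | hT
  · have hx : IsPath x (fun _ : ℝ≥0 => x) := ⟨rfl, LipschitzWith.const' x⟩
    refine ⟨fun _ => x, hx, fun s hs => ?_⟩
    rw [nonpos_iff_eq_zero.mp hs]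
    exact (hF.1 _ hx).1
  · have hT0 : 0 < T := pos_iff_ne_zero.mpr hT
    obtain ⟨g, hg, hgl⟩ := hF.exists_glue (G := Set.Iio T) h
    obtain ⟨l, hl, hlg⟩ := hg.exists_lipschitzWith_eqOn_Iio hT0
    have hagree : ∀ t < T, ∀ k, IsFixedUpTo x F k t → ∀ s ≤ t, k s = l s :=
      fun t ht k hk s hs => by
        rw [hlg s (hs.trans_lt ht)]
        exact hgl t ht k hk s (hs.trans_lt ht) hs
    have hpath : IsPath x l := by
      obtain ⟨k, hk⟩ := h 0 hT0
      exact ⟨by rw [← hagree 0 hT0 k hk 0 le_rfl, hk.1.1], hl⟩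
    refine ⟨l, hpath, (hF.1 l hpath).eq_of_eq_of_lt hpath fun s hs => ?_⟩
    obtain ⟨k, hk⟩ := h s hs
    exact (hF.isFixedUpTo_of_eq hk hpath (hagree s hs k hk)).2 s le_rfl

theorem IsStrictlyCausal.exists_isFixedUpTo [CompleteSpace X] (hF : IsStrictlyCausal x F)
    (t : ℝ≥0) : ∃ l, IsFixedUpTo x F l t := by
  by_contra hcon
  set S : Set ℝ≥0 := {t | ∃ l, IsFixedUpTo x F l t}
  have hbdd : BddAbove S := ⟨t, fun s ⟨l, hl⟩ => by
    by_contra! hs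
    exact hcon ⟨l, hl.mono hs.le⟩⟩
  have hne : S.Nonempty := ⟨0, hF.exists_isFixedUpTo_of_lt fun s hs => absurd hs not_lt_zero⟩
  obtain ⟨l, hl⟩ := hF.exists_isFixedUpTo_of_lt (T := sSup S) fun s hs => by
    obtain ⟨r, ⟨l, hl⟩, hsr⟩ := exists_lt_of_lt_csSup hne hs
    exact ⟨l, hl.mono hsr.le⟩
  obtain ⟨ε, hε, h⟩ := hF.exists_isFixedUpTo_add hl
  exact (lt_add_of_pos_right _ hε).not_ge (le_csSup hbdd ⟨_, h⟩)

theorem IsStrictlyCausal.exists_fixedPoint [CompleteSpace X] (hF : IsStrictlyCausal x F) :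
    ∃ l, IsPath x l ∧ F l = l := by
  have hex := hF.exists_isFixedUpTo
  obtain ⟨g, hg, hgl⟩ := hF.exists_glue (G := Set.univ) fun t _ => hex t
  have hagree : ∀ t k, IsFixedUpTo x F k t → ∀ s ≤ t, k s = g s :=
    fun t k hk s hs => hgl t trivial k hk s trivial hs
  have hpath : IsPath x g := by
    obtain ⟨k, hk⟩ := hex 0
    exact ⟨by rw [← hagree 0 k hk 0 le_rfl, hk.1.1], lipschitzOnWith_univ.mp hg⟩
  refine ⟨g, hpath, funext fun t => ?_⟩
  obtain ⟨k, hk⟩ := hex t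
  exact (hF.isFixedUpTo_of_eq hk hpath (hagree t k hk)).2 t le_rfl

theorem IsStrictlyCausal.fixedPoint_unique (hF : IsStrictlyCausal x F) {l l' : ℝ≥0 → X}
    (hl : IsPath x l) (hl' : IsPath x l') (h : F l = l) (h' : F l' = l') : l = l' :=
  funext fun t => hF.eq_of_isFixedUpTo (t := t) ⟨hl, fun s _ => congrFun h s⟩
    ⟨hl', fun s _ => congrFun h' s⟩ t le_rfl

end

/-- Let `X` be a complete metric space, `Ψ` a locally finite man strategy and `Φ` any
lion strategy. Then there are paths `l`, `m` with `Φ m = l` and `Ψ l = m`, and this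
pair is unique. -/
theorem locally_finite_unique_play
    {X : Type*} [MetricSpace X] [CompleteSpace X] (xL xM : X)
    (Ψ : (ℝ≥0 → X) → (ℝ≥0 → X)) (hΨ : IsManStrategy xL xM Ψ)
    (hlf : IsLocallyFiniteManStrategy xL Ψ)
    (Φ : (ℝ≥0 → X) → (ℝ≥0 → X)) (hΦ : IsLionStrategy xL xM Φ) :
    ∃ l m : ℝ≥0 → X, IsPath xL l ∧ IsPath xM m ∧ Φ m = l ∧ Ψ l = m ∧
      ∀ l' m' : ℝ≥0 → X, IsPath xL l' → IsPath xM m' → Φ m' = l' → Ψ l' = m' →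
        l' = l ∧ m' = m := by
  have hF : IsStrictlyCausal xL (fun l => Φ (Ψ l)) := by
    refine ⟨fun l hl => hΦ.1 _ (hΨ.1 l hl), fun l hl t => ?_⟩
    obtain ⟨ε, hε, h⟩ := hlf l hl t
    exact ⟨ε, hε, fun l' hl' hll' =>
      hΦ.2 _ _ (hΨ.1 l hl) (hΨ.1 l' hl') (t + ε) (h l' hl' hll')⟩
  obtain ⟨l, hl, hfix⟩ := hF.exists_fixedPoint
  refine ⟨l, Ψ l, hl, hΨ.1 l hl, hfix, rfl, fun l' m' hl' _ hlm hml => ?_⟩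
  subst hml
  obtain rfl := hF.fixedPoint_unique hl' hl hlm hfix
  exact ⟨rfl, rfl⟩

end
end

section
/- Let X be a complete metric space with fixed starting points, and suppose the man has a locally finite winning strategy for the lion and man game on X. Then the lion has no winning strategy: for every lion strategy Φ there exist a lion path l and a man path m with Φ(m) = l and l(t) ≠ m(t) for all t ≥ 0. -/
/-!
In a complete metric space, if the man has a locally finite winning strategy then the
lion has no winning strategy: against any lion strategy there is a play in which the
man is never caught.
-/

open NNReal

noncomputable section

/-- Real induction on `[0,∞)` for a downward closed predicate. -/
lemma nnreal_induction {P : ℝ≥0 → Prop} (zero : P 0)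
    (mono : ∀ s t, s ≤ t → P t → P s)
    (limit : ∀ T, 0 < T → (∀ t < T, P t) → P T)
    (step : ∀ t, P t → ∃ ε : ℝ≥0, 0 < ε ∧ P (t + ε)) (t : ℝ≥0) : P t := by
  by_contra ht
  have hbdd : BddAbove {r | P r} :=
    ⟨t, fun r hr => le_of_not_gt fun h => ht (mono t r h.le hr)⟩
  have hT : P (sSup {r | P r}) := by
    rcases eq_zero_or_pos (sSup {r | P r}) with h | h
    · rwa [h]
    · refine limit _ h fun r hr => ?_
      obtain ⟨q, hq, hrq⟩ := exists_lt_of_lt_csSup ⟨0, zero⟩ hr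
      exact mono r q hrq.le hq
  obtain ⟨ε, hε, h⟩ := step _ hT
  exact absurd (le_csSup hbdd h) (not_le.2 (lt_add_of_pos_right _ hε))

lemma eq_at_of_eq_of_lt {X : Type*} [MetricSpace X] {f g : ℝ≥0 → X}
    (hf : Continuous f) (hg : Continuous g) {T : ℝ≥0} (hT : 0 < T)
    (h : ∀ s < T, f s = g s) : f T = g T := by
  have hsub : closure (Set.Iio T) ⊆ {s | f s = g s} :=
    closure_minimal h (isClosed_eq hf hg)
  rw [closure_Iio' (show (Set.Iio T).Nonempty from ⟨0, hT⟩)] at hsub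
  exact hsub (Set.mem_Iic.2 le_rfl)

/-- A 1-Lipschitz map on `[0,T)` into a complete space extends to `[0,∞)`. -/
lemma exists_lipschitz_extension {X : Type*} [MetricSpace X] [CompleteSpace X]
    {F : ℝ≥0 → X} {T : ℝ≥0} (hT : 0 < T)
    (hF : ∀ s t, s ≤ t → t < T → dist (F s) (F t) ≤ dist s t) :
    ∃ f : ℝ≥0 → X, LipschitzWith 1 f ∧ ∀ s < T, f s = F s := by
  obtain ⟨u, -, hu, hlim⟩ := exists_seq_strictMono_tendsto' hT
  have hdist : ∀ s t, s < T → t < T → dist (F s) (F t) ≤ dist s t := by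
    intro s t hs ht
    rcases le_total s t with h | h
    · exact hF s t h ht
    · rw [dist_comm, dist_comm s]
      exact hF t s h hs
  have hcauchy : CauchySeq (F ∘ u) := by
    rw [Metric.cauchySeq_iff]
    intro ε hε
    obtain ⟨N, hN⟩ := Metric.cauchySeq_iff.1 hlim.cauchySeq ε hε
    exact ⟨N, fun a ha b hb =>
      (hdist _ _ (hu a).2 (hu b).2).trans_lt (hN a ha b hb)⟩
  obtain ⟨x, hx⟩ := cauchySeq_tendsto_of_complete hcauchy
  have hFx : ∀ s < T, dist (F s) x ≤ dist s T := fun s hs =>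
    le_of_tendsto_of_tendsto' (tendsto_const_nhds.dist hx)
      (tendsto_const_nhds.dist hlim) fun n => hdist _ _ hs (hu n).2
  have hle : ∀ s t : ℝ≥0, s < T → T ≤ t → dist (F s) x ≤ dist s t := by
    intro s t hs ht
    refine (hFx s hs).trans ?_
    have hs' : (s : ℝ) < T := hs
    have ht' : (T : ℝ) ≤ t := ht
    rw [NNReal.dist_eq, NNReal.dist_eq, abs_sub_comm, abs_sub_comm (s : ℝ),
      abs_of_nonneg (by linarith), abs_of_nonneg (by linarith)]
    linarith
  refine ⟨fun s => if s < T then F s else x, LipschitzWith.of_dist_le_mul fun s t => ?_,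
    fun s hs => if_pos hs⟩
  rw [NNReal.coe_one, one_mul]
  by_cases hs : s < T <;> by_cases ht : t < T <;> simp only [hs, ht, if_true, if_false]
  · exact hdist s t hs ht
  · exact hle s t hs (not_lt.1 ht)
  · rw [dist_comm, dist_comm s]
    exact hle t s ht (not_lt.1 hs)
  · simp

/-- The man path `m` is consistent with `Ψ` answering `Φ` during `[0,t]`. -/
def ConsistentUpTo {X : Type*} [MetricSpace X] (xM : X)
    (Φ Ψ : (ℝ≥0 → X) → (ℝ≥0 → X)) (m : ℝ≥0 → X) (t : ℝ≥0) : Prop :=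
  IsPath xM m ∧ ∀ s ≤ t, Ψ (Φ m) s = m s

section Consistent

variable {X : Type*} [MetricSpace X] {xL xM : X} {Φ Ψ : (ℝ≥0 → X) → (ℝ≥0 → X)}

lemma ConsistentUpTo.eqOn (hΦ : IsLionStrategy xL xM Φ)
    (hfin : IsLocallyFiniteManStrategy xL Ψ) {m m' : ℝ≥0 → X} {t : ℝ≥0}
    (hm : ConsistentUpTo xM Φ Ψ m t) (hm' : ConsistentUpTo xM Φ Ψ m' t) :
    ∀ s ≤ t, m s = m' s := by
  have key : ∀ r : ℝ≥0, ∀ s ≤ r, s ≤ t → m s = m' s := by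
    refine nnreal_induction ?_ ?_ ?_ ?_
    · intro s hs _
      rw [nonpos_iff_eq_zero.1 hs, hm.1.1, hm'.1.1]
    · exact fun q r hqr h s hs => h s (hs.trans hqr)
    · intro T hT h s hs hst
      rcases hs.lt_or_eq with hs | rfl
      · exact h s hs s le_rfl hst
      · exact eq_at_of_eq_of_lt hm.1.2.continuous hm'.1.2.continuous hT
          fun q hq => h q hq q le_rfl (hq.le.trans hst)
    · intro r h
      rcases le_total t r with htr | hrt
      · exact ⟨1, one_pos, fun s _ hst => h s (hst.trans htr) hst⟩
      · obtain ⟨ε, hε, hagree⟩ := hfin (Φ m) (hΦ.1 m hm.1) r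
        refine ⟨ε, hε, fun s hs hst => ?_⟩
        rw [← hm.2 s hst, ← hm'.2 s hst]
        exact hagree (Φ m') (hΦ.1 m' hm'.1)
          (hΦ.2 m m' hm.1 hm'.1 r fun q hq => h q hq (hq.trans hrt)) s hs
  exact fun s hs => key t s hs hs

lemma ConsistentUpTo.extend (hΦ : IsLionStrategy xL xM Φ) (hΨ : IsManStrategy xL xM Ψ)
    (hfin : IsLocallyFiniteManStrategy xL Ψ) {m : ℝ≥0 → X} {t : ℝ≥0}
    (hm : ConsistentUpTo xM Φ Ψ m t) :
    ∃ ε : ℝ≥0, 0 < ε ∧ ConsistentUpTo xM Φ Ψ (Ψ (Φ m)) (t + ε) := by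
  have hl := hΦ.1 m hm.1
  have hm₁ := hΨ.1 _ hl
  obtain ⟨ε, hε, h⟩ := hfin (Φ m) hl t
  refine ⟨ε, hε, hm₁, fun s hs => (h _ (hΦ.1 _ hm₁) ?_ s hs).symm⟩
  exact hΦ.2 m _ hm.1 hm₁ t fun q hq => (hm.2 q hq).symm

/-- Consistency up to time `t` depends only on the path during `[0,t]`. -/
lemma ConsistentUpTo.congr (hΦ : IsLionStrategy xL xM Φ) (hΨ : IsManStrategy xL xM Ψ)
    {m m' : ℝ≥0 → X} {t : ℝ≥0} (hm : ConsistentUpTo xM Φ Ψ m t) (hm' : IsPath xM m')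
    (h : ∀ s ≤ t, m s = m' s) : ConsistentUpTo xM Φ Ψ m' t := by
  refine ⟨hm', fun s hs => ?_⟩
  rw [← h s hs, ← hm.2 s hs]
  exact (hΨ.2 _ _ (hΦ.1 _ hm.1) (hΦ.1 _ hm') t (hΦ.2 _ _ hm.1 hm' t h) s hs).symm

lemma exists_consistentUpTo [CompleteSpace X] (hΦ : IsLionStrategy xL xM Φ)
    (hΨ : IsManStrategy xL xM Ψ) (hfin : IsLocallyFiniteManStrategy xL Ψ) (t : ℝ≥0) :
    ∃ m, ConsistentUpTo xM Φ Ψ m t := by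
  refine nnreal_induction (P := fun t => ∃ m, ConsistentUpTo xM Φ Ψ m t) ?_ ?_ ?_ ?_ t
  · have hc : IsPath xM fun _ => xM := ⟨rfl, LipschitzWith.const' xM⟩
    refine ⟨_, hc, fun s hs => ?_⟩
    rw [nonpos_iff_eq_zero.1 hs]
    exact (hΨ.1 _ (hΦ.1 _ hc)).1
  · exact fun s t hst ⟨m, hm⟩ => ⟨m, hm.1, fun q hq => hm.2 q (hq.trans hst)⟩
  · intro T hT h
    have : Nonempty X := ⟨xM⟩
    choose! M hM using h
    have hagree : ∀ s t, s ≤ t → t < T → M s s = M t s := fun s t hst ht =>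
      (hM s (hst.trans_lt ht)).eqOn hΦ hfin
        ⟨(hM t ht).1, fun q hq => (hM t ht).2 q (hq.trans hst)⟩ s le_rfl
    obtain ⟨m, hlip, hm⟩ := exists_lipschitz_extension (F := fun s => M s s) hT
      fun s t hst ht => by
        simpa [hagree s t hst ht] using (hM t ht).1.2.dist_le_mul s t
    have hpath : IsPath xM m := ⟨(hm 0 hT).trans (hM 0 hT).1.1, hlip⟩
    have hlt : ∀ s < T, Ψ (Φ m) s = m s := fun s hs =>
      ((hM s hs).congr hΦ hΨ hpath fun q hq => by
        rw [hm q (hq.trans_lt hs), hagree q s hq hs]).2 s le_rfl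
    refine ⟨m, hpath, fun s hs => ?_⟩
    rcases hs.lt_or_eq with hs | rfl
    · exact hlt s hs
    · exact eq_at_of_eq_of_lt (hΨ.1 _ (hΦ.1 _ hpath)).2.continuous hlip.continuous hT hlt
  · rintro t ⟨m, hm⟩
    obtain ⟨ε, hε, h⟩ := hm.extend hΦ hΨ hfin
    exact ⟨ε, hε, _, h⟩

/-- A lion strategy and a locally finite man strategy can be played against each other. -/
lemma exists_play [CompleteSpace X] (hΦ : IsLionStrategy xL xM Φ)
    (hΨ : IsManStrategy xL xM Ψ) (hfin : IsLocallyFiniteManStrategy xL Ψ) :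
    ∃ m, IsPath xM m ∧ Ψ (Φ m) = m := by
  choose M hM using exists_consistentUpTo hΦ hΨ hfin
  have hagree : ∀ s t, s ≤ t → M s s = M t s := fun s t hst =>
    (hM s).eqOn hΦ hfin ⟨(hM t).1, fun q hq => (hM t).2 q (hq.trans hst)⟩ s le_rfl
  have hpath : IsPath xM fun s => M s s := by
    refine ⟨(hM 0).1.1, LipschitzWith.of_dist_le_mul fun s t => ?_⟩
    rw [hagree s _ (le_max_left s t), hagree t _ (le_max_right s t)]
    exact (hM (max s t)).1.2.dist_le_mul s t
  exact ⟨_, hpath, funext fun t =>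
    ((hM t).congr hΦ hΨ hpath fun s hs => (hagree s t hs).symm).2 t le_rfl⟩

end Consistent

/-- Let `X` be a complete metric space in which the man has a locally finite winning
strategy. Then the lion has no winning strategy: for every lion strategy `Φ` there are
a lion path `l` and a man path `m` with `Φ m = l` and `l t ≠ m t` for all `t`. -/
theorem locally_finite_winning_man_beats_any_lion
    {X : Type*} [MetricSpace X] [CompleteSpace X] (xL xM : X)
    (h : ∃ Ψ, IsManStrategy xL xM Ψ ∧ IsLocallyFiniteManStrategy xL Ψ ∧
      ∀ l, IsPath xL l → ∀ t : ℝ≥0, Ψ l t ≠ l t)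
    (Φ : (ℝ≥0 → X) → (ℝ≥0 → X)) (hΦ : IsLionStrategy xL xM Φ) :
    ∃ l m : ℝ≥0 → X, IsPath xL l ∧ IsPath xM m ∧ Φ m = l ∧
      ∀ t : ℝ≥0, l t ≠ m t := by
  obtain ⟨Ψ, hΨ, hfin, hwin⟩ := h
  obtain ⟨m, hm, hfix⟩ := exists_play hΦ hΨ hfin
  have hl := hΦ.1 m hm
  refine ⟨Φ m, m, hl, hm, rfl, fun t ht => hwin (Φ m) hl t ?_⟩
  rw [hfix, ht]

end
end
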